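/- arXiv:2201.07128 — 8 statements merged into one kernel-verified Lean document; each statement's English description precedes it below -/
import Mathlib

section
/- Let n ≥ 2, s > 1 and k > 0. There exists a constant C, depending only on n and s and independent of k, such that for every continuously differentiable function φ : ℝⁿ → ℝ with support contained in B(k), one has ∫_{ℝⁿ} (1+k−|x|)^{s−2} φ(x)² dx ≤ C ( ∫_{ℝⁿ} (1+k−|x|)^{s} (∂_r φ(x))² dx + ∫_{ℝⁿ} (1+k−|x|)^{s} φ(x)²/|x|² dx ), provided the right-hand side is finite. -/
open MeasureTheory Metric

open Set in
/-- A function on a normed space has vanishing integral as soon as its weighted integral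
along every ray from the origin vanishes. -/
lemma integral_eq_zero_of_radial {E : Type*} [NormedAddCommGroup E] [NormedSpace ℝ E]
    [FiniteDimensional ℝ E] [Nontrivial E] [MeasurableSpace E] [BorelSpace E]
    (μ : Measure E) [μ.IsAddHaarMeasure] {G : E → ℝ}
    (hG : ∀ ω : E, ‖ω‖ = 1 →
      ∫ r in Ioi (0 : ℝ), r ^ (Module.finrank ℝ E - 1) * G (r • ω) = 0) :
    ∫ x, G x ∂μ = 0 := by
  have h1 : ∫ x, G x ∂μ = ∫ x : ({(0)}ᶜ : Set E), G x ∂(μ.comap (↑)) := by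
    rw [integral_subtype_comap (measurableSet_singleton _).compl G, restrict_compl_singleton]
  have h2 : ∫ x : ({(0)}ᶜ : Set E), G x ∂(μ.comap (↑)) =
      ∫ p, G (p.2.1 • p.1.1) ∂μ.toSphere.prod (.volumeIoiPow (Module.finrank ℝ E - 1)) := by
    rw [← μ.measurePreserving_homeomorphUnitSphereProd.integral_comp
        (Homeomorph.measurableEmbedding _)]
    refine integral_congr_ae (.of_forall fun x ↦ ?_)
    have hx : ‖(x : E)‖ ≠ 0 := norm_ne_zero_iff.2 x.2
    simp [smul_smul, hx]
  rw [h1, h2]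
  by_cases hi : Integrable (fun p : sphere (0 : E) 1 × Ioi (0 : ℝ) ↦ G (p.2.1 • p.1.1))
      (μ.toSphere.prod (.volumeIoiPow (Module.finrank ℝ E - 1)))
  · rw [integral_prod _ hi]
    refine integral_eq_zero_of_ae (.of_forall fun ω ↦ ?_)
    simp only [Measure.volumeIoiPow, ENNReal.ofReal, Pi.zero_apply]
    rw [integral_withDensity_eq_integral_smul,
      integral_subtype_comap measurableSet_Ioi
        fun a ↦ Real.toNNReal (a ^ (Module.finrank ℝ E - 1)) • G (a • ω.1)]
    · refine Eq.trans (setIntegral_congr_fun measurableSet_Ioi fun x (hx : 0 < x) ↦ ?_)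
        (hG ω.1 (by simp))
      simp only [NNReal.smul_def, Real.coe_toNNReal _ (pow_nonneg hx.le _), smul_eq_mul]
    · exact (measurable_subtype_coe.pow_const _).real_toNNReal
  · exact integral_undef hi

open Set in
/-- Integration by parts on a half-line: the integrand is the derivative of
`r ^ (m + 1) * (1 + k - r) ^ (s - 1) * u r ^ 2`. -/
lemma integral_Ioi_weighted_deriv_eq_zero (m : ℕ) {s k : ℝ} (hk : 0 < k)
    {u v : ℝ → ℝ} (hu : ∀ r, HasDerivAt u (v r) r) (hv : Continuous v)
    (hsupp : ∀ r, k < r → u r = 0) :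
    ∫ r in Ioi (0 : ℝ), r ^ (m + 1) *
      ((1 + k - r) ^ (s - 1) * (2 * u r * v r + (m + 1) * (u r ^ 2 / r))
        - (s - 1) * ((1 + k - r) ^ (s - 2) * u r ^ 2)) = 0 := by
  have hcu : Continuous u := continuous_iff_continuousAt.2 fun r ↦ (hu r).continuousAt
  set K : ℝ := k + 1 / 2 with hK
  have hK0 : 0 ≤ K := by positivity
  have hpos : ∀ r ∈ Icc 0 K, 1 + k - r ≠ 0 := fun r hr ↦ by
    have := hr.2
    linarith
  have hcw : ∀ t : ℝ, ContinuousOn (fun r : ℝ ↦ (1 + k - r) ^ t) (Icc 0 K) := fun t ↦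
    ContinuousOn.rpow_const (by fun_prop) fun r hr ↦ Or.inl (hpos r hr)
  let F : ℝ → ℝ := fun r ↦ r ^ (m + 1) * ((1 + k - r) ^ (s - 1) * u r ^ 2)
  let F' : ℝ → ℝ := fun r ↦
    (1 + k - r) ^ (s - 1) * (r ^ (m + 1) * (2 * u r * v r) + (m + 1) * r ^ m * u r ^ 2)
      - (s - 1) * r ^ (m + 1) * ((1 + k - r) ^ (s - 2) * u r ^ 2)
  have hF'c : ContinuousOn F' (Icc 0 K) := by
    have := hcw (s - 1)
    have := hcw (s - 2)
    fun_prop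
  have hF : ContinuousOn F (Icc 0 K) := by
    have := hcw (s - 1)
    fun_prop
  have hderiv : ∀ r ∈ Ioo 0 K, HasDerivAt F (F' r) r := by
    intro r hr
    have hw : HasDerivAt (fun r : ℝ ↦ (1 + k - r) ^ (s - 1))
        (-1 * (s - 1) * (1 + k - r) ^ (s - 1 - 1)) r :=
      ((hasDerivAt_id r).const_sub (1 + k)).rpow_const
        (Or.inl (hpos r (Ioo_subset_Icc_self hr)))
    have h := (hasDerivAt_pow (m + 1) r).mul (hw.mul ((hu r).pow 2))
    refine h.congr_deriv ?_
    rw [show s - 1 - 1 = s - 2 by ring]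
    simp only [F', Pi.mul_apply, Pi.pow_apply]
    push_cast
    ring
  have hint : ∫ r in (0 : ℝ)..K, F' r = 0 := by
    rw [intervalIntegral.integral_eq_sub_of_hasDerivAt_of_le hK0 hF hderiv
      (hF'c.intervalIntegrable_of_Icc hK0)]
    simp [F, hsupp K (by linarith)]
  rw [intervalIntegral.integral_of_le hK0] at hint
  rw [setIntegral_eq_of_subset_of_forall_sdiff_eq_zero measurableSet_Ioi
    (s := Ioc 0 K) Ioc_subset_Ioi_self]
  · refine Eq.trans (setIntegral_congr_fun measurableSet_Ioc fun r hr ↦ ?_) hint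
    have : r ≠ 0 := hr.1.ne'
    simp only [F']
    field_simp
    ring
  · intro r hr
    have : K < r := by
      by_contra! h
      exact hr.2 ⟨hr.1, h⟩
    simp [hsupp r (by linarith)]

/-- The Cauchy inequality with weight `δ` applied to both terms of the integrated derivative. -/
lemma weighted_cauchy {δ a w u v p d : ℝ} (hδ : 0 < δ) (ha : 0 ≤ a) (hd : 0 ≤ d) :
    |a * w * (2 * u * v + d * (u ^ 2 * p))| ≤
      (1 + d) * δ * (a * u ^ 2) +
        (1 + d) / δ * (a * w ^ 2 * v ^ 2 + a * w ^ 2 * (u ^ 2 * p ^ 2)) := by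
  have key : ∀ x y : ℝ, |2 * x * y| ≤ δ * x ^ 2 + y ^ 2 / δ := by
    intro x y
    have h1 : 0 ≤ (δ * x + y) ^ 2 / δ := by positivity
    have h2 : 0 ≤ (δ * x - y) ^ 2 / δ := by positivity
    have e1 : (δ * x + y) ^ 2 / δ = δ * x ^ 2 + y ^ 2 / δ + 2 * x * y := by field_simp; ring
    have e2 : (δ * x - y) ^ 2 / δ = δ * x ^ 2 + y ^ 2 / δ - 2 * x * y := by field_simp; ring
    rw [abs_le]
    constructor <;> linarith
  have e : a * w * (2 * u * v + d * (u ^ 2 * p)) =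
      a * (2 * u * (w * v)) + a * d / 2 * (2 * u * (w * u * p)) := by ring
  have had : 0 ≤ a * d / 2 := by positivity
  rw [e]
  refine (abs_add_le _ _).trans ?_
  rw [abs_mul a, abs_mul (a * d / 2), abs_of_nonneg ha, abs_of_nonneg had]
  have h1 := mul_le_mul_of_nonneg_left (key u (w * v)) ha
  have h2 := mul_le_mul_of_nonneg_left (key u (w * u * p)) had
  have h3 : 0 ≤ a * d * δ * u ^ 2 / 2 := by positivity
  have h4 : 0 ≤ a * d * (w * v) ^ 2 / δ := by positivity
  have h5 : 0 ≤ (a + a * d / 2) * (w * u * p) ^ 2 / δ := by positivity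
  have e3 : (1 + d) * δ * (a * u ^ 2) +
        (1 + d) / δ * (a * w ^ 2 * v ^ 2 + a * w ^ 2 * (u ^ 2 * p ^ 2)) =
      a * (δ * u ^ 2 + (w * v) ^ 2 / δ) + a * d / 2 * (δ * u ^ 2 + (w * u * p) ^ 2 / δ) +
        a * d * δ * u ^ 2 / 2 + a * d * (w * v) ^ 2 / δ
        + (a + a * d / 2) * (w * u * p) ^ 2 / δ := by
    field_simp
    ring
  linarith

/-- Weighted Hardy-type inequality for functions supported in a ball of a normed space. -/
lemma weighted_hardy {E : Type*} [NormedAddCommGroup E] [NormedSpace ℝ E]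
    [FiniteDimensional ℝ E] [MeasurableSpace E] [BorelSpace E]
    (μ : Measure E) [μ.IsAddHaarMeasure] {m : ℕ} (hm : Module.finrank ℝ E = m + 2)
    {s k δ : ℝ} (hk : 0 < k) (hδ : 0 < δ) (hδs : (m + 2) * δ < s - 1)
    {φ : E → ℝ} (hφ : ContDiff ℝ 1 φ) (hsupp : ∀ x, x ∉ closedBall (0 : E) k → φ x = 0)
    (hB : Integrable (fun x ↦ (1 + k - ‖x‖) ^ s * (fderiv ℝ φ x (‖x‖⁻¹ • x)) ^ 2) μ)
    (hD : Integrable (fun x ↦ (1 + k - ‖x‖) ^ s * (φ x) ^ 2 / ‖x‖ ^ 2) μ) :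
    ∫ x, (1 + k - ‖x‖) ^ (s - 2) * (φ x) ^ 2 ∂μ ≤
      (m + 2) / δ / (s - 1 - (m + 2) * δ) *
        (∫ x, (1 + k - ‖x‖) ^ s * (fderiv ℝ φ x (‖x‖⁻¹ • x)) ^ 2 ∂μ +
          ∫ x, (1 + k - ‖x‖) ^ s * (φ x) ^ 2 / ‖x‖ ^ 2 ∂μ) := by
  have : Nontrivial E := Module.nontrivial_of_finrank_pos (R := ℝ) (by omega)
  let V : E → ℝ := fun x ↦ fderiv ℝ φ x (‖x‖⁻¹ • x)
  let A : E → ℝ := fun x ↦ (1 + k - ‖x‖) ^ (s - 2) * (φ x) ^ 2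
  let B : E → ℝ := fun x ↦ (1 + k - ‖x‖) ^ s * (V x) ^ 2
  let D : E → ℝ := fun x ↦ (1 + k - ‖x‖) ^ s * (φ x) ^ 2 / ‖x‖ ^ 2
  let H : E → ℝ := fun x ↦
    (1 + k - ‖x‖) ^ (s - 1) * (2 * φ x * V x + (m + 1) * (φ x ^ 2 / ‖x‖))
  have hzero : ∀ x, k < ‖x‖ → φ x = 0 := fun x hx ↦ hsupp x (by simpa using hx)
  have hVzero : ∀ x, k < ‖x‖ → V x = 0 := by
    intro x hx
    have h : φ =ᶠ[nhds x] fun _ ↦ 0 := by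
      filter_upwards [(isOpen_lt continuous_const continuous_norm).mem_nhds hx] with y hy
      exact hzero y hy
    simp [V, h.fderiv_eq]
  have hφc : Continuous φ := hφ.continuous
  have hcs : HasCompactSupport φ := HasCompactSupport.intro (isCompact_closedBall 0 k) hsupp
  have hA : Integrable A μ := by
    have hAeq : A = fun x ↦ (max 1 (1 + k - ‖x‖)) ^ (s - 2) * (φ x * φ x) := by
      funext x
      rcases le_or_gt ‖x‖ k with hx | hx
      · simp only [A]
        rw [max_eq_right (by linarith), sq]
      · simp [A, hzero x hx]
    rw [hAeq]
    refine Continuous.integrable_of_hasCompactSupport ?_ (hcs.mul_left.mul_left)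
    refine Continuous.mul (Continuous.rpow_const (by fun_prop) fun x ↦ Or.inl ?_) (by fun_prop)
    exact (lt_of_lt_of_le one_pos (le_max_left _ _)).ne'
  have hH_le : ∀ x, |H x| ≤ (m + 2) * δ * A x + (m + 2) / δ * (B x + D x) := by
    intro x
    rcases le_or_gt ‖x‖ k with hx | hx
    · have hw : 0 < 1 + k - ‖x‖ := by linarith
      have h := weighted_cauchy (w := 1 + k - ‖x‖) (u := φ x) (v := V x) (p := ‖x‖⁻¹)
        (d := m + 1) hδ (Real.rpow_nonneg hw.le (s - 2)) (by positivity)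
      have e1 : (1 + k - ‖x‖) ^ (s - 1) = (1 + k - ‖x‖) ^ (s - 2) * (1 + k - ‖x‖) := by
        rw [← Real.rpow_add_one hw.ne']
        ring_nf
      have e2 : (1 + k - ‖x‖) ^ s = (1 + k - ‖x‖) ^ (s - 2) * (1 + k - ‖x‖) ^ 2 := by
        rw [← Real.rpow_add_natCast hw.ne']
        norm_num
      simp only [H, A, B, D, e1, e2, div_eq_mul_inv] at h ⊢
      convert h using 1
      ring
    · simp [H, A, B, D, hzero x hx, hVzero x hx]
  have hBD : Integrable (fun x ↦ B x + D x) μ := hB.add hD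
  have hVm : Measurable V := by
    have : Continuous fun p : E × E ↦ fderiv ℝ φ p.1 p.2 :=
      hφ.continuous_fderiv_apply one_ne_zero
    exact this.measurable.comp (measurable_id.prodMk (by fun_prop))
  have hH : Integrable H μ := by
    refine Integrable.mono' ((hA.const_mul _).add (hBD.const_mul _)) ?_
      (.of_forall fun x ↦ hH_le x)
    have := hφc.measurable
    exact Measurable.aestronglyMeasurable (by fun_prop)
  have hG : ∫ x, (H x - (s - 1) * A x) ∂μ = 0 := by
    refine integral_eq_zero_of_radial μ fun ω hω ↦ ?_
    have hdiff : ∀ r : ℝ, HasDerivAt (fun r : ℝ ↦ φ (r • ω)) (fderiv ℝ φ (r • ω) ω) r := by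
      intro r
      have h1 : HasDerivAt (fun r : ℝ ↦ r • ω) ω r := by
        simpa using (hasDerivAt_id r).smul_const ω
      exact ((hφ.differentiable one_ne_zero).differentiableAt.hasFDerivAt).comp_hasDerivAt r h1
    have hcont : Continuous fun r : ℝ ↦ fderiv ℝ φ (r • ω) ω :=
      ((hφ.continuous_fderiv one_ne_zero).comp (by fun_prop)).clm_apply continuous_const
    have h := integral_Ioi_weighted_deriv_eq_zero m (s := s) hk hdiff hcont
      fun r hr ↦ hzero _ (by simpa [norm_smul, hω] using hr.trans_le (le_abs_self r))
    rw [hm]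
    refine Eq.trans (setIntegral_congr_fun measurableSet_Ioi fun r (hr : 0 < r) ↦ ?_) h
    have hn : ‖r • ω‖ = r := by rw [norm_smul, hω, mul_one, Real.norm_of_nonneg hr.le]
    simp only [H, A, V, hn, smul_smul, inv_mul_cancel₀ hr.ne', one_smul]
    rfl
  rw [integral_sub hH (hA.const_mul _), integral_const_mul] at hG
  have hle : ∫ x, H x ∂μ ≤ ∫ x, ((m + 2) * δ * A x + (m + 2) / δ * (B x + D x)) ∂μ :=
    integral_mono hH ((hA.const_mul _).add (hBD.const_mul _))
      fun x ↦ (le_abs_self _).trans (hH_le x)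
  rw [integral_add (hA.const_mul _) (hBD.const_mul _), integral_const_mul, integral_const_mul,
    integral_add hB hD] at hle
  rw [div_mul_eq_mul_div, le_div_iff₀ (by linarith)]
  change (∫ x, A x ∂μ) * _ ≤ _ * (∫ x, B x ∂μ + ∫ x, D x ∂μ)
  linarith

/-- Weighted `L²`-to-`L²` estimate (Lemma 2.1): for `n ≥ 2`, `s > 1` there is a
constant `C = C(n,s)`, independent of `k > 0`, such that for every `C¹` function `φ`
supported in the ball `B(k)`,
`∫ (1+k-|x|)^{s-2} φ² ≤ C (∫ (1+k-|x|)^s (∂_r φ)² + ∫ (1+k-|x|)^s φ²/|x|²)`,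
provided the right-hand side is finite. Here `∂_r φ (x) = ∇φ(x)·x/|x|`. -/
theorem stmt_0 (n : ℕ) (hn : 2 ≤ n) (s : ℝ) (hs : 1 < s) :
    ∃ C : ℝ, 0 < C ∧ ∀ k : ℝ, 0 < k →
      ∀ φ : EuclideanSpace ℝ (Fin n) → ℝ, ContDiff ℝ 1 φ →
        (∀ x : EuclideanSpace ℝ (Fin n), x ∉ closedBall (0 : EuclideanSpace ℝ (Fin n)) k → φ x = 0) →
        Integrable (fun x : EuclideanSpace ℝ (Fin n) =>
          (1 + k - ‖x‖) ^ s * (fderiv ℝ φ x (‖x‖⁻¹ • x)) ^ 2) →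
        Integrable (fun x : EuclideanSpace ℝ (Fin n) =>
          (1 + k - ‖x‖) ^ s * (φ x) ^ 2 / ‖x‖ ^ 2) →
        (∫ x : EuclideanSpace ℝ (Fin n), (1 + k - ‖x‖) ^ (s - 2) * (φ x) ^ 2) ≤
          C * ((∫ x : EuclideanSpace ℝ (Fin n),
                (1 + k - ‖x‖) ^ s * (fderiv ℝ φ x (‖x‖⁻¹ • x)) ^ 2) +
              ∫ x : EuclideanSpace ℝ (Fin n), (1 + k - ‖x‖) ^ s * (φ x) ^ 2 / ‖x‖ ^ 2) := by
  obtain ⟨m, rfl⟩ := Nat.exists_eq_add_of_le' hn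
  have hm : (0 : ℝ) < m + 2 := by positivity
  have hs0 : 0 < s - 1 := by linarith
  set δ : ℝ := (s - 1) / (2 * (m + 2)) with hδ_def
  have hδ : 0 < δ := by positivity
  have hmδ : (m + 2) * δ = (s - 1) / 2 := by
    rw [hδ_def]
    field_simp
  have hδs : (m + 2) * δ < s - 1 := by linarith
  have hgap : 0 < s - 1 - (m + 2) * δ := by linarith
  refine ⟨(m + 2) / δ / (s - 1 - (m + 2) * δ), by positivity, fun k hk φ hφ hsupp hB hD ↦ ?_⟩
  exact weighted_hardy (E := EuclideanSpace ℝ (Fin (m + 2))) volume (by simp) hk hδ hδs hφ hsupp hB hD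
end

section
/- Let n ≥ 2, s > 1 and k ≥ 1. There exists a constant C, depending only on n and s and independent of k, such that for every continuously differentiable function φ : ℝⁿ → ℝ with support contained in B(k) and every r > 0, one has r^{n−2} (1+k+r) (1+k−r)^{s−1} ∫_{S^{n−1}} φ(rω)² dσ(ω) ≤ C ( ∫_{ℝⁿ} (1+k−|x|)^{s} (∂_r φ(x))² dx + ∫_{ℝⁿ} (1+k−|x|)^{s} φ(x)²/|x|² dx ), where σ is the surface measure on the unit sphere S^{n−1} ⊂ ℝⁿ. -/
open MeasureTheory Metric Set

/-- The constant in the radial weighted trace inequality in dimension `m + 2`. -/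
noncomputable def radialTraceConst (m : ℕ) (s : ℝ) : ℝ :=
  (m + 1) + ((2 * m + 1) ^ 2 + 16) / (8 * (s - 1))

lemma radialTraceConst_pos (m : ℕ) {s : ℝ} (hs : 1 < s) : 0 < radialTraceConst m s := by
  have : 0 < s - 1 := by linarith
  unfold radialTraceConst
  positivity

lemma quadratic_le_radialTraceConst (m : ℕ) {s : ℝ} (hs : 1 < s) (a b y : ℝ) :
    m * a ^ 2 + (2 * m + 1) * a * y - 2 * (s - 1) * y ^ 2 + 2 * a * b + 4 * y * b ≤
      radialTraceConst m s * (a ^ 2 + b ^ 2) := by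
  have hd : 0 < s - 1 := by linarith
  have h1 : (2 * m + 1) * a * y + 4 * y * b - 2 * (s - 1) * y ^ 2 ≤
      ((2 * m + 1) * a + 4 * b) ^ 2 / (8 * (s - 1)) := by
    rw [le_div_iff₀ (by positivity)]
    nlinarith [sq_nonneg ((2 * m + 1) * a + 4 * b - 4 * (s - 1) * y)]
  have h2 : ((2 * m + 1) * a + 4 * b) ^ 2 / (8 * (s - 1)) ≤
      ((2 * m + 1) ^ 2 + 16) / (8 * (s - 1)) * (a ^ 2 + b ^ 2) := by
    rw [div_mul_eq_mul_div]
    gcongr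
    nlinarith [sq_nonneg ((2 * m + 1) * b - 4 * a)]
  have h3 : m * a ^ 2 + 2 * a * b ≤ (m + 1) * (a ^ 2 + b ^ 2) := by
    have : (0 : ℝ) ≤ m * b ^ 2 := by positivity
    nlinarith [sq_nonneg (a - b)]
  unfold radialTraceConst
  linarith

/-- If `p` is continuous and nonnegative and `p ρ / ρ` is dominated near `0` by an integrable
function, then `p` vanishes at `0`. -/
lemma eq_zero_of_div_le_integrable {p R : ℝ → ℝ} {r : ℝ} (hr : 0 < r)
    (hp : ContinuousOn p (Icc 0 r)) (hp0 : 0 ≤ p 0) (hR : IntegrableOn R (Ioc 0 r))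
    (hpR : ∀ ρ ∈ Ioo 0 r, p ρ / ρ ≤ R ρ) : p 0 = 0 := by
  by_contra hne
  have hpos : 0 < p 0 := lt_of_le_of_ne hp0 (Ne.symm hne)
  have hev : ∀ᶠ ρ in nhdsWithin 0 (Icc 0 r), p 0 / 2 < p ρ :=
    (hp 0 ⟨le_rfl, hr.le⟩).eventually (lt_mem_nhds (half_lt_self hpos))
  obtain ⟨d, hd, hball⟩ := Metric.mem_nhdsWithin_iff.1 hev
  set e := min (d / 2) (r / 2)
  have he : 0 < e := by positivity
  have hed : e < d := (min_le_left _ _).trans_lt (half_lt_self hd)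
  have her : e < r := (min_le_right _ _).trans_lt (half_lt_self hr)
  have hint : IntegrableOn (fun ρ : ℝ => ρ⁻¹) (Ioc 0 e) := by
    refine Integrable.mono' (((hR.mono_set (Ioc_subset_Ioc_right her.le)).const_mul (2 / p 0)))
      (measurable_inv.aestronglyMeasurable) ?_
    filter_upwards [ae_restrict_mem measurableSet_Ioc] with ρ hρ
    have h1 : p 0 / 2 < p ρ := hball ⟨by
      rw [Metric.mem_ball, Real.dist_eq, sub_zero, abs_of_pos hρ.1]
      exact hρ.2.trans_lt hed, hρ.1.le, hρ.2.trans her.le⟩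
    have h2 := hpR ρ ⟨hρ.1, hρ.2.trans_lt her⟩
    rw [Real.norm_of_nonneg (inv_nonneg.2 hρ.1.le)]
    calc ρ⁻¹ = 2 / p 0 * (p 0 / 2 / ρ) := by have := hρ.1.ne'; field_simp
      _ ≤ 2 / p 0 * (p ρ / ρ) := by
        have := hρ.1
        gcongr
      _ ≤ 2 / p 0 * R ρ := by gcongr
  have := (intervalIntegrable_inv_iff (a := 0) (b := e)).1
    ((intervalIntegrable_iff_integrableOn_Ioc_of_le he.le).2 hint)
  rcases this with h | h
  · exact he.ne h
  · exact h (by simp)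

/-- The one-dimensional weighted trace inequality, along a single ray in dimension `m + 2`. -/
lemma radial_trace_le (m : ℕ) {s K r : ℝ} (hs : 1 < s) (hr : 0 < r) (hrK : r < K)
    {f f' : ℝ → ℝ} (hf : ∀ ρ, HasDerivAt f (f' ρ) ρ)
    (hint : IntegrableOn (fun ρ => ρ ^ (m + 1) *
      ((K - ρ) ^ s * f' ρ ^ 2 + (K - ρ) ^ s * f ρ ^ 2 / ρ ^ 2)) (Ioc 0 r)) :
    r ^ m * (K + r) * (K - r) ^ (s - 1) * f r ^ 2 ≤
      radialTraceConst m s * ∫ ρ in Ioc 0 r, ρ ^ (m + 1) *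
        ((K - ρ) ^ s * f' ρ ^ 2 + (K - ρ) ^ s * f ρ ^ 2 / ρ ^ 2) := by
  have hfc : Continuous f := continuous_iff_continuousAt.2 fun ρ => (hf ρ).continuousAt
  have hK : 0 < K := hr.trans hrK
  have hw : ∀ q : ℝ, ContinuousOn (fun ρ : ℝ => (K - ρ) ^ q) (Icc 0 r) := fun q =>
    (by fun_prop : ContinuousOn (fun ρ : ℝ => K - ρ) (Icc 0 r)).rpow_const
      fun ρ hρ => Or.inl (by linarith [hρ.2])
  have hzero : (0 : ℝ) ^ m * (K - 0) ^ s * f 0 ^ 2 = 0 := by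
    refine eq_zero_of_div_le_integrable (p := fun ρ => ρ ^ m * (K - ρ) ^ s * f ρ ^ 2) hr
      (((by fun_prop : ContinuousOn (fun ρ : ℝ => ρ ^ m) (Icc 0 r)).mul (hw s)).mul
        (hfc.pow 2).continuousOn) ?_ hint ?_
    · have : 0 ≤ (K - 0) ^ s := Real.rpow_nonneg (by linarith) _
      positivity
    · intro ρ hρ
      have hρ0 := hρ.1
      have hW : 0 ≤ (K - ρ) ^ s := Real.rpow_nonneg (by linarith [hρ.2]) _
      calc ρ ^ m * (K - ρ) ^ s * f ρ ^ 2 / ρ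
          = ρ ^ (m + 1) * (0 + (K - ρ) ^ s * f ρ ^ 2 / ρ ^ 2) := by field_simp; ring
        _ ≤ _ := by gcongr; positivity
  set G : ℝ → ℝ := fun ρ => ρ ^ m * (K + ρ) * (K - ρ) ^ (s - 1) * f ρ ^ 2 with hG
  have hG0 : G 0 = 0 := by
    have h1 : (K - 0) ^ s ≠ 0 := (Real.rpow_pos_of_pos (by linarith) _).ne'
    have h2 : (0 : ℝ) ^ m * f 0 ^ 2 = 0 := by
      rcases mul_eq_zero.1 hzero with h | h
      · rw [(mul_eq_zero.1 h).resolve_right h1, zero_mul]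
      · rw [h, mul_zero]
    calc G 0 = (0 ^ m * f 0 ^ 2) * ((K + 0) * (K - 0) ^ (s - 1)) := by simp only [hG]; ring
      _ = 0 := by rw [h2, zero_mul]
  have hGc : ContinuousOn G (Icc 0 r) :=
    ((by fun_prop : ContinuousOn (fun ρ : ℝ => ρ ^ m * (K + ρ)) (Icc 0 r)).mul (hw _)).mul
      (hfc.pow 2).continuousOn
  have key := intervalIntegral.sub_le_integral_of_hasDeriv_right_of_le (g := G)
    (g' := fun ρ => ((m * ρ ^ (m - 1) * (K + ρ) + ρ ^ m * 1) * (K - ρ) ^ (s - 1) +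
      ρ ^ m * (K + ρ) * (-1 * (s - 1) * (K - ρ) ^ (s - 1 - 1))) * f ρ ^ 2 +
      ρ ^ m * (K + ρ) * (K - ρ) ^ (s - 1) * (2 * f ρ * f' ρ))
    (φ := fun ρ => radialTraceConst m s * (ρ ^ (m + 1) *
        ((K - ρ) ^ s * f' ρ ^ 2 + (K - ρ) ^ s * f ρ ^ 2 / ρ ^ 2))) hr.le hGc ?_ ?_ ?_
  · rw [hG0, sub_zero, intervalIntegral.integral_of_le hr.le, integral_const_mul] at key
    exact key
  · intro ρ hρ
    have hwρ : K - ρ ≠ 0 := by linarith [hρ.2]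
    have := (((hasDerivAt_pow m ρ).mul ((hasDerivAt_id ρ).const_add K)).mul
      (((hasDerivAt_id ρ).const_sub K).rpow_const (p := s - 1) (Or.inl hwρ))).mul ((hf ρ).pow 2)
    refine (this.congr_deriv ?_).hasDerivWithinAt
    simp
  · rw [integrableOn_Icc_iff_integrableOn_Ioc]
    exact hint.const_mul _
  · intro ρ hρ
    have hρ0 := hρ.1
    have hwρ : 0 < K - ρ := by linarith [hρ.2]
    have hu : 0 < (K - ρ) ^ (s - 1 - 1) := Real.rpow_pos_of_pos hwρ _
    have e1 : (K - ρ) ^ (s - 1) = (K - ρ) * (K - ρ) ^ (s - 1 - 1) := by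
      rw [mul_comm, ← Real.rpow_add_one hwρ.ne']; ring_nf
    have e2 : (K - ρ) ^ s = (K - ρ) ^ 2 * (K - ρ) ^ (s - 1 - 1) := by
      rw [pow_two, mul_assoc, ← e1, mul_comm, ← Real.rpow_add_one hwρ.ne']; ring_nf
    have e3 : (m : ℝ) * ρ ^ (m - 1) = m * (ρ ^ m / ρ) := by
      rcases m with _ | m
      · simp
      · rw [Nat.add_sub_cancel, pow_succ, mul_div_cancel_right₀ _ hρ0.ne']
    have hq := quadratic_le_radialTraceConst m hs ((K - ρ) * f ρ / ρ) ((K - ρ) * f' ρ) (f ρ)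
    simp only [e1, e2, e3]
    set u := (K - ρ) ^ (s - 1 - 1)
    set w := K - ρ with hwdef
    have hKe : K = w + ρ := by rw [hwdef]; ring
    rw [hKe]
    set y := f ρ
    set z := f' ρ
    set C := radialTraceConst m s
    have hP : 0 < ρ ^ m := by positivity
    calc _ = ρ ^ m * u * ρ * (m * (w * y / ρ) ^ 2 + (2 * m + 1) * (w * y / ρ) * y
            - 2 * (s - 1) * y ^ 2 + 2 * (w * y / ρ) * (w * z) + 4 * y * (w * z))
            - ρ ^ m * u * ((s - 1) * w * y ^ 2) := by
          field_simp
          ring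
      _ ≤ ρ ^ m * u * ρ * (C * ((w * y / ρ) ^ 2 + (w * z) ^ 2)) := by
          have : 0 ≤ ρ ^ m * u * ((s - 1) * w * y ^ 2) := by
            have : 0 < s - 1 := by linarith
            positivity
          have : ρ ^ m * u * ρ * (m * (w * y / ρ) ^ 2 + (2 * m + 1) * (w * y / ρ) * y
            - 2 * (s - 1) * y ^ 2 + 2 * (w * y / ρ) * (w * z) + 4 * y * (w * z)) ≤
             ρ ^ m * u * ρ * (C * ((w * y / ρ) ^ 2 + (w * z) ^ 2)) := by gcongr
          linarith
      _ = _ := by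
          field_simp
          ring

section Polar

variable {E : Type*} [NormedAddCommGroup E] [NormedSpace ℝ E] [MeasurableSpace E]
  [BorelSpace E] [FiniteDimensional ℝ E] [Nontrivial E] (μ : Measure E) [μ.IsAddHaarMeasure]

lemma integral_volumeIoiPow (d : ℕ) (g : ℝ → ℝ) :
    ∫ ρ : Ioi (0 : ℝ), g ρ ∂(Measure.volumeIoiPow d) = ∫ ρ in Ioi (0 : ℝ), ρ ^ d * g ρ := by
  simp only [Measure.volumeIoiPow, ENNReal.ofReal]
  rw [integral_withDensity_eq_integral_smul ((measurable_subtype_coe.pow_const _).real_toNNReal),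
    integral_subtype_comap measurableSet_Ioi fun a ↦ Real.toNNReal (a ^ d) • g a]
  refine setIntegral_congr_fun measurableSet_Ioi fun x hx ↦ ?_
  rw [NNReal.smul_def, Real.coe_toNNReal _ (pow_nonneg hx.out.le _), smul_eq_mul]

lemma integrable_volumeIoiPow_iff (d : ℕ) (g : ℝ → ℝ) :
    Integrable (fun ρ : Ioi (0 : ℝ) => g ρ) (Measure.volumeIoiPow d) ↔
      IntegrableOn (fun ρ => ρ ^ d * g ρ) (Ioi 0) := by
  simp only [Measure.volumeIoiPow, ENNReal.ofReal]
  rw [integrable_withDensity_iff_integrable_smul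
      ((measurable_subtype_coe.pow_const _).real_toNNReal),
    integrableOn_iff_comap_subtypeVal measurableSet_Ioi]
  refine integrable_congr (.of_forall fun x => ?_)
  simp only [Function.comp_apply]
  rw [NNReal.smul_def, Real.coe_toNNReal _ (pow_nonneg x.2.out.le _), smul_eq_mul]

/-- Integration in polar coordinates. -/
lemma integral_polar {F : E → ℝ} (hF : Integrable F μ) :
    (∀ᵐ ω : sphere (0 : E) 1 ∂μ.toSphere,
      IntegrableOn (fun ρ : ℝ => ρ ^ (Module.finrank ℝ E - 1) * F (ρ • (ω : E))) (Ioi 0)) ∧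
    Integrable (fun ω : sphere (0 : E) 1 =>
      ∫ ρ in Ioi (0 : ℝ), ρ ^ (Module.finrank ℝ E - 1) * F (ρ • (ω : E))) μ.toSphere ∧
    ∫ x, F x ∂μ = ∫ ω : sphere (0 : E) 1,
      (∫ ρ in Ioi (0 : ℝ), ρ ^ (Module.finrank ℝ E - 1) * F (ρ • (ω : E))) ∂μ.toSphere := by
  set H : sphere (0 : E) 1 × Ioi (0 : ℝ) → ℝ := fun p => F ((p.2 : ℝ) • (p.1 : E)) with hH
  have hcomp : ∀ x : ({0}ᶜ : Set E), H (homeomorphUnitSphereProd E x) = F x := by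
    rintro ⟨x, hx⟩
    have hx0 : x ≠ 0 := hx
    simp [hH, smul_smul, hx0]
  have hmp := μ.measurePreserving_homeomorphUnitSphereProd
  have hemb := (homeomorphUnitSphereProd E).measurableEmbedding
  have hHint : Integrable H (μ.toSphere.prod (.volumeIoiPow (Module.finrank ℝ E - 1))) := by
    rw [← hmp.integrable_comp_emb hemb]
    have h : H ∘ homeomorphUnitSphereProd E = F ∘ Subtype.val := funext hcomp
    rw [h, ← integrableOn_iff_comap_subtypeVal (measurableSet_singleton _).compl]
    exact hF.integrableOn
  have hval : ∫ x, F x ∂μ =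
      ∫ p, H p ∂(μ.toSphere.prod (.volumeIoiPow (Module.finrank ℝ E - 1))) := by
    rw [← hmp.integral_comp hemb]
    simp only [hcomp]
    rw [integral_subtype_comap (measurableSet_singleton _).compl F, restrict_compl_singleton]
  have hin : ∀ ω : sphere (0 : E) 1,
      ∫ ρ, H (ω, ρ) ∂(Measure.volumeIoiPow (Module.finrank ℝ E - 1)) =
        ∫ ρ in Ioi (0 : ℝ), ρ ^ (Module.finrank ℝ E - 1) * F (ρ • (ω : E)) := fun ω =>
    integral_volumeIoiPow _ fun ρ => F (ρ • (ω : E))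
  refine ⟨?_, ?_, ?_⟩
  · filter_upwards [hHint.prod_right_ae] with ω hω
    exact (integrable_volumeIoiPow_iff _ fun ρ => F (ρ • (ω : E))).1 hω
  · simpa only [hin] using hHint.integral_prod_left
  · rw [hval, integral_prod _ hHint]
    simp only [hin]

end Polar



/-- Proposition 2.2: for `n ≥ 2`, `s > 1` there is a constant `C = C(n,s)`, independent
of `k ≥ 1`, such that for every `C¹` function `φ` supported in `B(k)` and every `r > 0`,
`r^{n-2} (1+k+r)(1+k-r)^{s-1} ∫_{S^{n-1}} φ(rω)² dσ(ω)
  ≤ C (∫ (1+k-|x|)^s (∂_r φ)² + ∫ (1+k-|x|)^s φ²/|x|²)`,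
where `σ` is the surface measure on the unit sphere, realized as `volume.toSphere`. -/
theorem stmt_1 (n : ℕ) (hn : 2 ≤ n) (s : ℝ) (hs : 1 < s) :
    ∃ C : ℝ, 0 < C ∧ ∀ k : ℝ, 1 ≤ k →
      ∀ φ : EuclideanSpace ℝ (Fin n) → ℝ, ContDiff ℝ 1 φ →
        (∀ x : EuclideanSpace ℝ (Fin n), x ∉ closedBall (0 : EuclideanSpace ℝ (Fin n)) k → φ x = 0) →
        Integrable (fun x : EuclideanSpace ℝ (Fin n) =>
          (1 + k - ‖x‖) ^ s * (fderiv ℝ φ x (‖x‖⁻¹ • x)) ^ 2) →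
        Integrable (fun x : EuclideanSpace ℝ (Fin n) =>
          (1 + k - ‖x‖) ^ s * (φ x) ^ 2 / ‖x‖ ^ 2) →
        ∀ r : ℝ, 0 < r →
          r ^ ((n : ℝ) - 2) * (1 + k + r) * (1 + k - r) ^ (s - 1) *
            (∫ ω : sphere (0 : EuclideanSpace ℝ (Fin n)) 1,
              (φ (r • (ω : EuclideanSpace ℝ (Fin n)))) ^ 2
              ∂((volume : Measure (EuclideanSpace ℝ (Fin n))).toSphere)) ≤
          C * ((∫ x : EuclideanSpace ℝ (Fin n),
                (1 + k - ‖x‖) ^ s * (fderiv ℝ φ x (‖x‖⁻¹ • x)) ^ 2) +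
              ∫ x : EuclideanSpace ℝ (Fin n), (1 + k - ‖x‖) ^ s * (φ x) ^ 2 / ‖x‖ ^ 2) := by
  obtain ⟨m, rfl⟩ : ∃ m, n = m + 2 := ⟨n - 2, by omega⟩
  have hC := radialTraceConst_pos m hs
  refine ⟨radialTraceConst m s, hC, ?_⟩
  intro k hk φ hφ hsupp hi1 hi2 r hr
  set F : EuclideanSpace ℝ (Fin (m + 2)) → ℝ := fun x =>
    (1 + k - ‖x‖) ^ s * (fderiv ℝ φ x (‖x‖⁻¹ • x)) ^ 2 +
    (1 + k - ‖x‖) ^ s * (φ x) ^ 2 / ‖x‖ ^ 2 with hFdef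
  have hFint : Integrable F := hi1.add hi2
  rw [← integral_add hi1 hi2]
  change _ ≤ radialTraceConst m s * ∫ x, F x
  have hF0 : ∀ x, 0 ≤ F x := by
    intro x
    by_cases hx : ‖x‖ ≤ k
    · have : 0 ≤ (1 + k - ‖x‖) ^ s := Real.rpow_nonneg (by linarith) _
      simp only [hFdef]
      positivity
    · have hev : φ =ᶠ[nhds x] fun _ => 0 := by
        filter_upwards [isClosed_closedBall.isOpen_compl.mem_nhds
          (show x ∈ (closedBall (0 : EuclideanSpace ℝ (Fin (m + 2))) k)ᶜ by simpa using hx)] with y hy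
        exact hsupp y hy
      have h1 : fderiv ℝ φ x = 0 := by rw [hev.fderiv_eq]; simp
      simp [hFdef, h1, hev.eq_of_nhds]
  have hsph : ∀ ω : sphere (0 : EuclideanSpace ℝ (Fin (m + 2))) 1, ‖ω.1‖ = 1 := fun ω => by simp
  rcases lt_or_ge k r with hkr | hrk
  · have h0 : ∀ ω : sphere (0 : EuclideanSpace ℝ (Fin (m + 2))) 1, φ (r • ω.1) = 0 := fun ω => by
      apply hsupp
      simpa [norm_smul, abs_of_pos hr] using hkr
    simp only [h0]
    simpa using mul_nonneg hC.le (integral_nonneg hF0)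
  · obtain ⟨hae, hint, heq⟩ :=
      integral_polar (volume : Measure (EuclideanSpace ℝ (Fin (m + 2)))) hFint
    have hdim : Module.finrank ℝ (EuclideanSpace ℝ (Fin (m + 2))) - 1 = m + 1 := by simp
    simp only [hdim] at hae hint heq
    have hexp : r ^ (((m + 2 : ℕ) : ℝ) - 2) = r ^ m := by
      rw [← Real.rpow_natCast]
      push_cast
      ring_nf
    rw [heq, hexp, ← integral_const_mul, ← integral_const_mul]
    have hcont : Continuous fun ω : sphere (0 : EuclideanSpace ℝ (Fin (m + 2))) 1 => (φ (r • ω.1)) ^ 2 :=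
      (hφ.continuous.comp (continuous_subtype_val.const_smul r)).pow 2
    refine integral_mono_ae (Integrable.const_mul
      (hcont.integrable_of_hasCompactSupport (.of_compactSpace _)) _) (hint.const_mul _) ?_
    filter_upwards [hae] with ω hω
    have hderiv : ∀ ρ : ℝ, HasDerivAt (fun ρ : ℝ => φ (ρ • ω.1))
        (fderiv ℝ φ (ρ • ω.1) ω) ρ := fun ρ => by
      have h1 := (hφ.differentiable one_ne_zero (ρ • ω.1)).hasFDerivAt
      have h2 : HasDerivAt (fun ρ : ℝ => ρ • ω.1) ω.1 ρ := by
        simpa using (hasDerivAt_id ρ).smul_const ω.1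
      exact h1.comp_hasDerivAt ρ h2
    have hcongr : ∀ ρ ∈ Ioc (0 : ℝ) r, ρ ^ (m + 1) * F (ρ • ω.1) =
        ρ ^ (m + 1) * ((1 + k - ρ) ^ s * fderiv ℝ φ (ρ • ω.1) ω ^ 2 +
          (1 + k - ρ) ^ s * φ (ρ • ω.1) ^ 2 / ρ ^ 2) := by
      intro ρ hρ
      have hn : ‖ρ • ω.1‖ = ρ := by rw [norm_smul, hsph, mul_one, Real.norm_of_nonneg hρ.1.le]
      simp only [hFdef, hn, smul_smul, inv_mul_cancel₀ hρ.1.ne', one_smul]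
    have hω' : IntegrableOn (fun ρ : ℝ => ρ ^ (m + 1) * F (ρ • ω.1)) (Ioc 0 r) :=
      hω.mono_set Ioc_subset_Ioi_self
    refine (radial_trace_le m hs hr (by linarith : r < 1 + k) hderiv
      (hω'.congr_fun hcongr measurableSet_Ioc)).trans ?_
    gcongr
    rw [← setIntegral_congr_fun measurableSet_Ioc hcongr]
    refine setIntegral_mono_set hω ?_ (Filter.Eventually.of_forall Ioc_subset_Ioi_self)
    filter_upwards [ae_restrict_mem measurableSet_Ioi] with ρ hρ
    exact mul_nonneg (pow_nonneg (le_of_lt hρ) _) (hF0 _)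
end

section
/- Let s ≥ 0 and k ≥ 1. For every continuously differentiable function φ : ℝ³ → ℝ with support contained in B(k), one has ∫_{ℝ³} (1+k−|x|)^{s} ( ∂_r φ(x) )² dx ≤ ∫_{ℝ³} (1+k−|x|)^{s} ( ∂_r φ(x) + φ(x)/|x| )² dx. -/
open MeasureTheory Metric

/-- A function on a nontrivial finite-dimensional real normed space has nonnegative integral if
its weighted integral along every ray from the origin is nonnegative. -/
theorem integral_nonneg_of_integral_ray_nonneg {E : Type*} [NormedAddCommGroup E]
    [NormedSpace ℝ E] [MeasurableSpace E] [BorelSpace E] [FiniteDimensional ℝ E] [Nontrivial E]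
    (μ : Measure E) [μ.IsAddHaarMeasure] (f : E → ℝ)
    (h : ∀ ω : E, ‖ω‖ = 1 →
      0 ≤ ∫ r in Set.Ioi (0 : ℝ), r ^ (Module.finrank ℝ E - 1) * f (r • ω)) :
    0 ≤ ∫ x, f x ∂μ := by
  by_cases hf : Integrable f μ
  swap
  · rw [integral_undef hf]
  let g : sphere (0 : E) 1 × Set.Ioi (0 : ℝ) → ℝ := fun p ↦ f (p.2.1 • p.1.1)
  have hg : ∀ x : ({(0)}ᶜ : Set E), g (homeomorphUnitSphereProd E x) = f x := by
    rintro ⟨x, hx⟩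
    have hx' : ‖x‖ ≠ 0 := norm_ne_zero_iff.2 hx
    simp [g, smul_smul, hx']
  have hmp := μ.measurePreserving_homeomorphUnitSphereProd
  have hemb := (homeomorphUnitSphereProd E).measurableEmbedding
  have hgi : Integrable g
      (μ.toSphere.prod (Measure.volumeIoiPow (Module.finrank ℝ E - 1))) := by
    rw [← hmp.integrable_comp_emb hemb]
    have : g ∘ homeomorphUnitSphereProd E = f ∘ Subtype.val := funext hg
    rw [this, ← integrableOn_iff_comap_subtypeVal (by measurability)]
    exact hf.integrableOn
  have key : ∫ x, f x ∂μ =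
      ∫ p, g p ∂(μ.toSphere.prod (Measure.volumeIoiPow (Module.finrank ℝ E - 1))) := by
    rw [← hmp.integral_comp hemb]
    simp only [hg]
    rw [integral_subtype_comap (measurableSet_singleton _).compl f, restrict_compl_singleton]
  rw [key, integral_prod _ hgi]
  refine integral_nonneg fun ω ↦ ?_
  have hω := h ω.1 (by simp)
  simp only [Measure.volumeIoiPow, ENNReal.ofReal, Pi.zero_apply]
  rw [integral_withDensity_eq_integral_smul
      ((measurable_subtype_coe.pow_const _).real_toNNReal),
    integral_subtype_comap measurableSet_Ioi
      fun a ↦ Real.toNNReal (a ^ (Module.finrank ℝ E - 1)) • f (a • ω.1)]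
  refine hω.trans_eq (setIntegral_congr_fun measurableSet_Ioi fun r hr ↦ ?_)
  rw [Set.mem_Ioi] at hr
  simp only [NNReal.smul_def, Real.coe_toNNReal _ (pow_nonneg hr.le _), smul_eq_mul]

/-- One-dimensional weighted inequality along a ray: `∫ w (r ψ²)' ≥ 0` for the decreasing weight
`w r = (c - r) ^ s` and `ψ` vanishing at the right endpoint. -/
theorem integral_rpow_mul_deriv_nonneg {s b c : ℝ} (hs : 0 ≤ s) (hb : 0 ≤ b) (hbc : b < c)
    {ψ ψ' : ℝ → ℝ} (hψ : ∀ r, HasDerivAt ψ (ψ' r) r) (hψ' : Continuous ψ') (hψb : ψ b = 0) :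
    0 ≤ ∫ r in (0 : ℝ)..b, (c - r) ^ s * (2 * r * ψ r * ψ' r + ψ r ^ 2) := by
  have hψc : Continuous ψ := continuous_iff_continuousAt.2 fun r ↦ (hψ r).continuousAt
  have hw : ContinuousOn (fun r : ℝ ↦ (c - r) ^ s) (Set.Icc 0 b) :=
    ContinuousOn.rpow_const (by fun_prop) fun r hr ↦ Or.inl (by linarith [hr.2])
  have := intervalIntegral.sub_le_integral_of_hasDeriv_right_of_le
    (g := fun r ↦ (c - r) ^ s * (r * ψ r ^ 2))
    (g' := fun r ↦ (-1 * s * (c - r) ^ (s - 1)) * (r * ψ r ^ 2) +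
      (c - r) ^ s * (1 * ψ r ^ 2 + r * (2 * ψ r * ψ' r)))
    (φ := fun r ↦ (c - r) ^ s * (2 * r * ψ r * ψ' r + ψ r ^ 2)) hb
    (hw.mul (by fun_prop)) ?_ ((hw.mul (by fun_prop)).integrableOn_Icc) ?_
  · simpa [hψb] using this
  · intro r hr
    have h1 : HasDerivAt (fun r : ℝ ↦ (c - r) ^ s) (-1 * s * (c - r) ^ (s - 1)) r :=
      ((hasDerivAt_id r).const_sub c).rpow_const (Or.inl (by simp; linarith [hr.2]))
    have h2 : HasDerivAt (fun r : ℝ ↦ ψ r ^ 2) (2 * ψ r * ψ' r) r := by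
      simpa using (hψ r).fun_pow 2
    exact (h1.mul ((hasDerivAt_id r).mul h2)).hasDerivWithinAt
  · intro r hr
    have h1 : 0 ≤ (c - r) ^ (s - 1) := Real.rpow_nonneg (by linarith [hr.2]) _
    have h2 : 0 ≤ s * (c - r) ^ (s - 1) * (r * ψ r ^ 2) :=
      mul_nonneg (mul_nonneg hs h1) (mul_nonneg hr.1.le (sq_nonneg _))
    linear_combination h2

/-- A function on `ℝ³` that is supported in a ball and `O(1 + 1/|x|)` is square integrable against
the weight `(1 + k - |x|) ^ s`. -/
theorem integrable_rpow_mul_sq {s k M : ℝ} (hs : 0 ≤ s) (hk : 0 ≤ k)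
    {h : EuclideanSpace ℝ (Fin 3) → ℝ} (hm : Measurable h)
    (hbound : ∀ x, |h x| ≤ M + M / ‖x‖) (hzero : ∀ x, k < ‖x‖ → h x = 0) :
    Integrable fun x : EuclideanSpace ℝ (Fin 3) ↦ (1 + k - ‖x‖) ^ s * h x ^ 2 := by
  have hint : Integrable fun x : EuclideanSpace ℝ (Fin 3) ↦
      (Set.Iic k).indicator (fun r ↦ (1 + k) ^ s * (M + M / r) ^ 2) ‖x‖ := by
    rw [integrable_fun_norm_addHaar volume
      (f := (Set.Iic k).indicator fun r ↦ (1 + k) ^ s * (M + M / r) ^ 2)]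
    have : IntegrableOn ((Set.Iic k).indicator fun r : ℝ ↦ (1 + k) ^ s * (M * r + M) ^ 2)
        (Set.Ioi 0) := by
      rw [IntegrableOn, integrable_indicator_iff measurableSet_Iic, IntegrableOn,
        Measure.restrict_restrict measurableSet_Iic, Set.inter_comm, Set.Ioi_inter_Iic]
      exact (Continuous.integrableOn_Icc (by fun_prop)).mono_set Set.Ioc_subset_Icc_self
    refine this.congr_fun (fun r hr ↦ ?_) measurableSet_Ioi
    have hr' : r ≠ 0 := ne_of_gt hr
    by_cases hrk : r ≤ k
    · simp [hrk]
      field_simp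
    · simp [hrk]
  refine hint.mono' (by fun_prop) (Filter.Eventually.of_forall fun x ↦ ?_)
  by_cases hx : ‖x‖ ≤ k
  · have h0 : 0 ≤ 1 + k - ‖x‖ := by linarith
    rw [Set.indicator_of_mem (Set.mem_Iic.2 hx), Real.norm_of_nonneg
      (mul_nonneg (Real.rpow_nonneg h0 _) (sq_nonneg _))]
    refine mul_le_mul (Real.rpow_le_rpow h0 (by linarith [norm_nonneg x]) hs) ?_
      (sq_nonneg _) (Real.rpow_nonneg (by linarith) _)
    rw [← sq_abs (h x)]
    exact pow_le_pow_left₀ (abs_nonneg _) (hbound x) 2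
  · rw [Set.indicator_of_notMem (by simpa using hx), hzero x (not_le.1 hx)]
    simp

/-- Hardy-type inequality (2.4): for `s ≥ 0`, `k ≥ 1` and every `C¹` function
`φ : ℝ³ → ℝ` supported in `B(k)`,
`∫ (1+k-|x|)^s (∂_r φ)² ≤ ∫ (1+k-|x|)^s (∂_r φ + φ/|x|)²`. -/
theorem stmt_3 (s k : ℝ) (hs : 0 ≤ s) (hk : 1 ≤ k)
    (φ : EuclideanSpace ℝ (Fin 3) → ℝ) (hφ : ContDiff ℝ 1 φ)
    (hsupp : ∀ x : EuclideanSpace ℝ (Fin 3),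
      x ∉ closedBall (0 : EuclideanSpace ℝ (Fin 3)) k → φ x = 0) :
    (∫ x : EuclideanSpace ℝ (Fin 3), (1 + k - ‖x‖) ^ s * (fderiv ℝ φ x (‖x‖⁻¹ • x)) ^ 2) ≤
      ∫ x : EuclideanSpace ℝ (Fin 3),
        (1 + k - ‖x‖) ^ s * (fderiv ℝ φ x (‖x‖⁻¹ • x) + φ x / ‖x‖) ^ 2 := by
  have hk0 : 0 ≤ k := zero_le_one.trans hk
  have hφc : Continuous φ := hφ.continuous
  have hφ' : Continuous (fderiv ℝ φ) := hφ.continuous_fderiv one_ne_zero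
  have hzero : ∀ x, k < ‖x‖ → φ x = 0 := fun x hx ↦ hsupp x (by simpa using hx)
  have hcs : HasCompactSupport φ :=
    HasCompactSupport.intro (isCompact_closedBall 0 k) hsupp
  have hzero' : ∀ x, k < ‖x‖ → fderiv ℝ φ x = 0 := fun x hx ↦ by
    have : φ =ᶠ[nhds x] fun _ ↦ 0 := by
      filter_upwards [(isOpen_lt continuous_const continuous_norm).mem_nhds hx] with y hy
      exact hzero y hy
    rw [this.fderiv_eq]
    simp
  obtain ⟨A, hA⟩ := hcs.exists_bound_of_continuous hφc
  obtain ⟨B, hB⟩ := (hcs.fderiv ℝ).exists_bound_of_continuous hφ'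
  have hA0 : 0 ≤ A := (norm_nonneg _).trans (hA 0)
  have hB0 : 0 ≤ B := (norm_nonneg _).trans (hB 0)
  have hD : ∀ x, |fderiv ℝ φ x (‖x‖⁻¹ • x)| ≤ B := fun x ↦ by
    refine ((fderiv ℝ φ x).le_opNorm _).trans ?_
    refine (mul_le_of_le_one_right (norm_nonneg _) ?_).trans (hB x)
    rw [norm_smul, norm_inv, norm_norm]
    exact inv_mul_le_one
  have hDm : Measurable fun x ↦ fderiv ℝ φ x (‖x‖⁻¹ • x) := by
    have h1 : Continuous fun x ↦ fderiv ℝ φ x x := hφ'.clm_apply continuous_id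
    simp only [map_smul, smul_eq_mul]
    exact measurable_norm.inv.mul h1.measurable
  have hI1 : Integrable fun x : EuclideanSpace ℝ (Fin 3) ↦
      (1 + k - ‖x‖) ^ s * (fderiv ℝ φ x (‖x‖⁻¹ • x)) ^ 2 := by
    refine integrable_rpow_mul_sq (M := B) hs hk0 hDm (fun x ↦ ?_) fun x hx ↦ by simp [hzero' x hx]
    have : 0 ≤ B / ‖x‖ := by positivity
    linarith [hD x]
  have hI2 : Integrable fun x : EuclideanSpace ℝ (Fin 3) ↦
      (1 + k - ‖x‖) ^ s * (fderiv ℝ φ x (‖x‖⁻¹ • x) + φ x / ‖x‖) ^ 2 := by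
    refine integrable_rpow_mul_sq (M := A + B) hs hk0
      (hDm.add (hφc.measurable.div measurable_norm)) (fun x ↦ ?_)
      fun x hx ↦ by simp [hzero' x hx, hzero x hx]
    refine (abs_add_le _ _).trans (add_le_add ((hD x).trans (by linarith)) ?_)
    rw [abs_div, abs_norm]
    gcongr
    exact (hA x).trans (by linarith)
  rw [← sub_nonneg, ← integral_sub hI2 hI1]
  refine integral_nonneg_of_integral_ray_nonneg volume _ fun ω hω ↦ ?_
  have hray : ∀ r : ℝ, HasDerivAt (fun r : ℝ ↦ φ (r • ω)) (fderiv ℝ φ (r • ω) ω) r := fun r ↦ by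
    have h1 : HasDerivAt (fun r : ℝ ↦ r • ω) ω r := by
      simpa using (hasDerivAt_id r).smul_const ω
    exact ((hφ.differentiable one_ne_zero) (r • ω)).hasFDerivAt.comp_hasDerivAt r h1
  have hnorm : ∀ r : ℝ, 0 < r → ‖r • ω‖ = r := fun r hr ↦ by
    rw [norm_smul, hω, mul_one, Real.norm_of_nonneg hr.le]
  have hb : (0 : ℝ) < k + 1 / 2 := by linarith
  have h1d := integral_rpow_mul_deriv_nonneg (c := 1 + k) hs hb.le (by linarith) hray
    ((hφ'.comp (by fun_prop)).clm_apply continuous_const)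
    (hzero _ (by rw [hnorm _ hb]; linarith))
  rw [intervalIntegral.integral_of_le hb.le] at h1d
  refine h1d.trans_eq ?_
  rw [setIntegral_eq_of_subset_of_forall_sdiff_eq_zero measurableSet_Ioi
    (Set.Ioc_subset_Ioi_self : Set.Ioc 0 (k + 1 / 2) ⊆ Set.Ioi (0 : ℝ))]
  · refine setIntegral_congr_fun measurableSet_Ioc fun r hr ↦ ?_
    have hr0 : r ≠ 0 := hr.1.ne'
    simp only [hnorm r hr.1, finrank_euclideanSpace, Fintype.card_fin, smul_smul,
      inv_mul_cancel₀ hr0, one_smul]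
    field_simp
    ring
  · intro r hr
    have hr0 : 0 < r := hr.1
    have hrk : k < ‖r • ω‖ := by
      rw [hnorm r hr0]
      have : ¬ r ≤ k + 1 / 2 := fun h ↦ hr.2 ⟨hr0, h⟩
      linarith
    simp [hzero _ hrk, hzero' _ hrk]
end

section
/- Let s ≥ 0 and k ≥ 1. For every continuously differentiable function φ : ℝ³ → ℝ with support contained in B(k), one has the exact identity ∫_{ℝ³} (1+k−|x|)^{s} ( ∂_r φ(x) + φ(x)/|x| )² dx = ∫_{ℝ³} (1+k−|x|)^{s} ( ∂_r φ(x) )² dx + s ∫_{ℝ³} (1+k−|x|)^{s−1} φ(x)²/|x| dx. -/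
open MeasureTheory Metric

open Set in
/-- Integration in polar coordinates on a nontrivial finite-dimensional real normed space. -/
theorem integral_eq_integral_toSphere {E : Type*} [NormedAddCommGroup E] [NormedSpace ℝ E]
    [FiniteDimensional ℝ E] [MeasurableSpace E] [BorelSpace E] [Nontrivial E]
    (μ : Measure E) [μ.IsAddHaarMeasure] {F : E → ℝ} (hF : Integrable F μ) :
    ∫ x, F x ∂μ = ∫ ω : sphere (0 : E) 1,
      ∫ r in Ioi (0 : ℝ), r ^ (Module.finrank ℝ E - 1) * F (r • (ω : E)) ∂volume ∂μ.toSphere := by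
  have hcomp (x : ({0}ᶜ : Set E)) : F x.1 =
      (fun p : sphere (0 : E) 1 × Ioi (0 : ℝ) ↦ F (p.2.1 • p.1.1))
        (homeomorphUnitSphereProd E x) := by
    have h := homeomorphUnitSphereProd_symm_apply_coe E (homeomorphUnitSphereProd E x)
    rw [Homeomorph.symm_apply_apply] at h
    exact congrArg F h
  have hpres := μ.measurePreserving_homeomorphUnitSphereProd
  have hemb := (homeomorphUnitSphereProd E).measurableEmbedding
  have hint : Integrable (fun p : sphere (0 : E) 1 × Ioi (0 : ℝ) ↦ F (p.2.1 • p.1.1))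
      (μ.toSphere.prod (.volumeIoiPow (Module.finrank ℝ E - 1))) := by
    rw [← hpres.integrable_comp_emb hemb]
    have h : IntegrableOn F {0}ᶜ μ := hF.integrableOn
    rw [integrableOn_iff_comap_subtypeVal (measurableSet_singleton _).compl] at h
    exact h.congr (.of_forall hcomp)
  calc
    ∫ x, F x ∂μ = ∫ x : ({0}ᶜ : Set E), F x.1 ∂(μ.comap (↑)) := by
      rw [integral_subtype_comap (measurableSet_singleton _).compl F,
        restrict_compl_singleton]
    _ = ∫ p : sphere (0 : E) 1 × Ioi (0 : ℝ), F (p.2.1 • p.1.1)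
        ∂μ.toSphere.prod (.volumeIoiPow (Module.finrank ℝ E - 1)) := by
      simp_rw [hcomp]
      exact hpres.integral_comp hemb fun p ↦ F (p.2.1 • p.1.1)
    _ = ∫ ω : sphere (0 : E) 1, ∫ r : Ioi (0 : ℝ), F (r.1 • ω.1)
        ∂(.volumeIoiPow (Module.finrank ℝ E - 1)) ∂μ.toSphere := integral_prod _ hint
    _ = _ := by
      congr 1 with ω
      simp only [Measure.volumeIoiPow, ENNReal.ofReal]
      rw [integral_withDensity_eq_integral_smul,
        integral_subtype_comap measurableSet_Ioi
          fun a ↦ Real.toNNReal (a ^ (Module.finrank ℝ E - 1)) • F (a • (ω : E)),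
        setIntegral_congr_fun measurableSet_Ioi fun x hx ↦ ?_]
      · rw [NNReal.smul_def, Real.coe_toNNReal _ (pow_nonneg hx.out.le _), smul_eq_mul]
      · exact (measurable_subtype_coe.pow_const _).real_toNNReal

/-- In dimension three, a function supported in `B(k)` and dominated by a multiple of `‖x‖⁻²`
remains integrable after multiplication by any power of `1 + k - ‖x‖`. -/
theorem integrable_rpow_mul_of_mul_norm_sq_le {k C : ℝ} (hk : 0 ≤ k) (p : ℝ)
    {g : EuclideanSpace ℝ (Fin 3) → ℝ} (hg : Measurable g)
    (hsupp : ∀ x, k < ‖x‖ → g x = 0) (hbound : ∀ x, ‖x‖ ≤ k → |g x| * ‖x‖ ^ 2 ≤ C) :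
    Integrable fun x ↦ (1 + k - ‖x‖) ^ p * g x := by
  obtain ⟨W, hW⟩ : ∃ W, ∀ r ∈ Set.Icc 0 k, ‖(1 + k - r) ^ p‖ ≤ W := by
    refine isCompact_Icc.exists_bound_of_continuousOn
      (ContinuousOn.rpow_const (by fun_prop) fun r hr ↦ Or.inl ?_)
    linarith [hr.2]
  have hW0 : 0 ≤ W := (norm_nonneg _).trans (hW 0 ⟨le_rfl, hk⟩)
  have hC0 : 0 ≤ C := by simpa using hbound 0 (by simpa using hk)
  have hmeas : Measurable fun x : EuclideanSpace ℝ (Fin 3) ↦ (1 + k - ‖x‖) ^ p * g x := by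
    fun_prop
  have hdecay : ∀ᵐ x : EuclideanSpace ℝ (Fin 3),
      ‖(1 + k - ‖x‖) ^ p * g x‖ ≤ W * C * ‖x‖ ^ (-(2 : ℝ)) := by
    filter_upwards [(Set.countable_singleton 0).ae_notMem volume] with x hx
    have hx0 : 0 < ‖x‖ := norm_pos_iff.mpr hx
    rw [Real.rpow_neg hx0.le, Real.rpow_two, ← div_eq_mul_inv, le_div_iff₀ (by positivity),
      norm_mul, mul_assoc]
    rcases le_or_gt ‖x‖ k with h | h
    · exact mul_le_mul (hW _ ⟨hx0.le, h⟩) (hbound x h) (by positivity) hW0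
    · simpa [hsupp x h] using mul_nonneg hW0 hC0
  have hball := integrableOn_ball_of_norm_le_rpow (r := k + 1) (by simp) (by simp; norm_num)
    (ae_restrict_of_ae hdecay) hmeas.aestronglyMeasurable
  refine (integrableOn_iff_integrable_of_support_subset fun x hx ↦ ?_).mp hball
  contrapose! hx
  have h : k < ‖x‖ := by
    rw [mem_ball_zero_iff, not_lt] at hx
    linarith
  simp [hsupp x h]

/-- The derivative of `r (1 + k - r) ^ s φ(r ω)²` integrates to zero along every ray, provided `φ`
vanishes outside `B(k)`. -/
theorem integral_Ioi_radial_eq_zero {E : Type*} [NormedAddCommGroup E] [NormedSpace ℝ E]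
    {s k : ℝ} (hk : 0 ≤ k) {φ : E → ℝ} (hφ : ContDiff ℝ 1 φ)
    (hsupp : ∀ x, k < ‖x‖ → φ x = 0) {ω : E} (hω : ‖ω‖ = 1) :
    ∫ r in Set.Ioi (0 : ℝ), ((1 + k - r) ^ s * (2 * r * φ (r • ω) * fderiv ℝ φ (r • ω) ω
      + φ (r • ω) ^ 2) - s * (1 + k - r) ^ (s - 1) * r * φ (r • ω) ^ 2) = 0 := by
  have hzero (r : ℝ) (hr : k < r) : φ (r • ω) = 0 := by
    apply hsupp
    rwa [norm_smul, hω, mul_one, Real.norm_of_nonneg (hk.trans hr.le)]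
  have hpos (r : ℝ) (hr : r ∈ Set.uIcc 0 (k + 1 / 2)) : 1 + k - r ≠ 0 := by
    rw [Set.uIcc_of_le (by linarith)] at hr
    linarith [hr.2]
  have hderiv (r : ℝ) (hr : r ∈ Set.uIcc 0 (k + 1 / 2)) :
      HasDerivAt (fun r ↦ (1 + k - r) ^ s * (r * φ (r • ω) ^ 2))
        ((1 + k - r) ^ s * (2 * r * φ (r • ω) * fderiv ℝ φ (r • ω) ω + φ (r • ω) ^ 2)
          - s * (1 + k - r) ^ (s - 1) * r * φ (r • ω) ^ 2) r := by
    have hw := ((hasDerivAt_id r).const_sub (1 + k)).rpow_const (p := s) (Or.inl (hpos r hr))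
    have hray : HasDerivAt (fun r : ℝ ↦ r • ω) ω r := by
      simpa using (hasDerivAt_id r).smul_const ω
    have hφr := ((hφ.differentiable one_ne_zero) (r • ω)).hasFDerivAt.comp_hasDerivAt r hray
    refine (hw.mul ((hasDerivAt_id r).mul (hφr.pow 2))).congr_deriv ?_
    simp
    ring
  have hφc := hφ.continuous
  have hφ'c := hφ.continuous_fderiv one_ne_zero
  have hcont : ContinuousOn (fun r ↦ (1 + k - r) ^ s * (2 * r * φ (r • ω) * fderiv ℝ φ (r • ω) ω
      + φ (r • ω) ^ 2) - s * (1 + k - r) ^ (s - 1) * r * φ (r • ω) ^ 2)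
      (Set.uIcc 0 (k + 1 / 2)) := by
    have hw (p : ℝ) : ContinuousOn (fun r ↦ (1 + k - r) ^ p) (Set.uIcc 0 (k + 1 / 2)) :=
      ContinuousOn.rpow_const (by fun_prop) fun r hr ↦ Or.inl (hpos r hr)
    have hw1 := hw s
    have hw2 := hw (s - 1)
    fun_prop
  have hftc := intervalIntegral.integral_eq_sub_of_hasDerivAt hderiv hcont.intervalIntegrable
  rw [intervalIntegral.integral_of_le (by linarith), hzero (k + 1 / 2) (by linarith)] at hftc
  rw [setIntegral_eq_of_subset_of_forall_sdiff_eq_zero measurableSet_Ioi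
    (Set.Ioc_subset_Ioi_self : Set.Ioc 0 (k + 1 / 2) ⊆ _), hftc]
  · simp
  · intro r hr
    have hkr : k + 1 / 2 < r := by
      by_contra! h
      exact hr.2 ⟨hr.1, h⟩
    simp [hzero r (by linarith)]

/-- The exact identity behind Lemma 2.3: for `s ≥ 0`, `k ≥ 1` and every `C¹` function
`φ : ℝ³ → ℝ` supported in `B(k)`,
`∫ (1+k-|x|)^s (∂_r φ + φ/|x|)² = ∫ (1+k-|x|)^s (∂_r φ)² + s ∫ (1+k-|x|)^{s-1} φ²/|x|`. -/
theorem stmt_4 (s k : ℝ) (hs : 0 ≤ s) (hk : 1 ≤ k)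
    (φ : EuclideanSpace ℝ (Fin 3) → ℝ) (hφ : ContDiff ℝ 1 φ)
    (hsupp : ∀ x : EuclideanSpace ℝ (Fin 3),
      x ∉ closedBall (0 : EuclideanSpace ℝ (Fin 3)) k → φ x = 0) :
    (∫ x : EuclideanSpace ℝ (Fin 3),
        (1 + k - ‖x‖) ^ s * (fderiv ℝ φ x (‖x‖⁻¹ • x) + φ x / ‖x‖) ^ 2) =
      (∫ x : EuclideanSpace ℝ (Fin 3),
          (1 + k - ‖x‖) ^ s * (fderiv ℝ φ x (‖x‖⁻¹ • x)) ^ 2) +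
        s * ∫ x : EuclideanSpace ℝ (Fin 3), (1 + k - ‖x‖) ^ (s - 1) * (φ x) ^ 2 / ‖x‖ := by
  have hk0 : 0 ≤ k := by linarith
  have hφ0 (x : EuclideanSpace ℝ (Fin 3)) (hx : k < ‖x‖) : φ x = 0 :=
    hsupp x (by simpa using hx)
  have hφ'0 (x : EuclideanSpace ℝ (Fin 3)) (hx : k < ‖x‖) : fderiv ℝ φ x = 0 := by
    have h : φ =ᶠ[nhds x] fun _ ↦ 0 := by
      filter_upwards [continuous_norm.continuousAt.eventually (lt_mem_nhds hx)] with y hy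
      exact hφ0 y hy
    rw [h.fderiv_eq, fderiv_const_apply]
  have hφm : Measurable φ := hφ.continuous.measurable
  have hφc := hφ.continuous
  have hφ'c : Continuous (fderiv ℝ φ) := hφ.continuous_fderiv one_ne_zero
  have hφ'm : Measurable fun x ↦ fderiv ℝ φ x (‖x‖⁻¹ • x) := by
    have h : (fun x ↦ fderiv ℝ φ x (‖x‖⁻¹ • x)) = fun x ↦ ‖x‖⁻¹ * fderiv ℝ φ x x := by
      ext x; simp
    rw [h]
    exact measurable_norm.inv.mul (hφ'c.clm_apply continuous_id).measurable
  obtain ⟨M, hM⟩ :=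
    (isCompact_closedBall (0 : EuclideanSpace ℝ (Fin 3)) k).exists_bound_of_continuousOn
      hφc.continuousOn
  obtain ⟨N, hN⟩ :=
    (isCompact_closedBall (0 : EuclideanSpace ℝ (Fin 3)) k).exists_bound_of_continuousOn
      hφ'c.continuousOn
  have hM' (x : EuclideanSpace ℝ (Fin 3)) (hx : ‖x‖ ≤ k) : |φ x| ≤ M := hM x (by simpa using hx)
  have hN' (x : EuclideanSpace ℝ (Fin 3)) (hx : ‖x‖ ≤ k) : |fderiv ℝ φ x (‖x‖⁻¹ • x)| ≤ N := by
    refine ((fderiv ℝ φ x).le_opNorm_of_le (c := 1) ?_).trans ?_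
    · rw [norm_smul, norm_inv, norm_norm]
      exact inv_mul_le_one
    · simpa using hN x (by simpa using hx)
  have hM0 : 0 ≤ M := (abs_nonneg _).trans (hM' 0 (by simpa using hk0))
  have hN0 : 0 ≤ N := (abs_nonneg _).trans (hN' 0 (by simpa using hk0))
  have hA : Integrable fun x : EuclideanSpace ℝ (Fin 3) ↦
      (1 + k - ‖x‖) ^ s * (fderiv ℝ φ x (‖x‖⁻¹ • x) + φ x / ‖x‖) ^ 2 := by
    refine integrable_rpow_mul_of_mul_norm_sq_le (C := (N * k + M) ^ 2) hk0 s (by fun_prop)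
      (fun x hx ↦ by simp [hφ0 x hx, hφ'0 x hx]) fun x hx ↦ ?_
    rw [abs_of_nonneg (sq_nonneg _), ← mul_pow, sq_le_sq,
      abs_of_nonneg (a := N * k + M) (by positivity),
      add_mul]
    refine (abs_add_le _ _).trans (add_le_add ?_ ?_)
    · rw [abs_mul, abs_norm]
      exact mul_le_mul (hN' x hx) hx (norm_nonneg _) hN0
    · rcases eq_or_ne ‖x‖ 0 with h | h
      · simpa [h] using hM0
      · rw [div_mul_cancel₀ _ h]
        exact hM' x hx
  have hB : Integrable fun x : EuclideanSpace ℝ (Fin 3) ↦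
      (1 + k - ‖x‖) ^ s * (fderiv ℝ φ x (‖x‖⁻¹ • x)) ^ 2 := by
    refine integrable_rpow_mul_of_mul_norm_sq_le (C := (N * k) ^ 2) hk0 s (by fun_prop)
      (fun x hx ↦ by simp [hφ'0 x hx]) fun x hx ↦ ?_
    rw [abs_of_nonneg (sq_nonneg _), ← mul_pow, sq_le_sq,
      abs_of_nonneg (a := N * k) (by positivity),
      abs_mul, abs_norm]
    exact mul_le_mul (hN' x hx) hx (norm_nonneg _) hN0
  have hD : Integrable fun x : EuclideanSpace ℝ (Fin 3) ↦
      (1 + k - ‖x‖) ^ (s - 1) * (φ x) ^ 2 / ‖x‖ := by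
    simp_rw [mul_div_assoc]
    refine integrable_rpow_mul_of_mul_norm_sq_le (C := M ^ 2 * k) hk0 (s - 1) (by fun_prop)
      (fun x hx ↦ by simp [hφ0 x hx]) fun x hx ↦ ?_
    have h : |φ x ^ 2 / ‖x‖| * ‖x‖ ^ 2 = |φ x| ^ 2 * ‖x‖ := by
      rw [abs_of_nonneg (by positivity), sq_abs]
      rcases eq_or_ne ‖x‖ 0 with h | h
      · simp [h]
      · field_simp
    rw [h]
    gcongr
    exact hM' x hx
  rw [← sub_eq_zero, ← integral_const_mul, ← integral_add' hB (hD.const_mul s),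
    ← integral_sub' hA (hB.add (hD.const_mul s)),
    integral_eq_integral_toSphere volume (hA.sub (hB.add (hD.const_mul s)))]
  refine integral_eq_zero_of_ae (.of_forall fun ω ↦ ?_)
  have hω : ‖(ω : EuclideanSpace ℝ (Fin 3))‖ = 1 := by simp
  refine (setIntegral_congr_fun measurableSet_Ioi fun r hr ↦ ?_).trans
    (integral_Ioi_radial_eq_zero (s := s) hk0 hφ hφ0 hω)
  have hr0 : 0 < r := hr
  have hnorm : ‖r • (ω : EuclideanSpace ℝ (Fin 3))‖ = r := by
    rw [norm_smul, hω, mul_one, Real.norm_of_nonneg hr0.le]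
  simp only [hnorm, finrank_euclideanSpace_fin, Pi.add_apply, Pi.sub_apply,
    inv_smul_smul₀ hr0.ne']
  field_simp
  ring
end

section
/- Let χ : (0,∞) → ℝ be continuous and suppose χ(r) ≥ c for all r > 0, with c > 3/4. Then for every smooth compactly supported function u : ℝ³ → ℝ vanishing in a neighborhood of the origin, one has (c − 3/4) ( ∫_{ℝ³} u(x)² / |x|⁴ dx )^{1/2} ≤ ( ∫_{ℝ³} | −Δu(x) + χ(|x|) u(x)/|x|² |² dx )^{1/2}. -/
open MeasureTheory Set

/-- The Laplacian of `u : ℝ³ → ℝ`, as the sum of the second partial derivatives. -/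
noncomputable def laplacian3 (u : EuclideanSpace ℝ (Fin 3) → ℝ)
    (x : EuclideanSpace ℝ (Fin 3)) : ℝ :=
  ∑ i : Fin 3, fderiv ℝ (fun y => fderiv ℝ u y (EuclideanSpace.single i (1 : ℝ))) x
    (EuclideanSpace.single i (1 : ℝ))

open scoped Topology

/-- The `i`-th component of the vector field `-u ∇u / |x|² - u² x / (2 |x|⁴)`. -/
noncomputable def hardyField (u : EuclideanSpace ℝ (Fin 3) → ℝ) (i : Fin 3)
    (x : EuclideanSpace ℝ (Fin 3)) : ℝ :=
  -(u x * fderiv ℝ u x (EuclideanSpace.single i (1 : ℝ)) / ‖x‖ ^ 2)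
    - u x ^ 2 * x i / (2 * (‖x‖ ^ 2) ^ 2)

lemma contDiff_fderiv_apply_const {u : EuclideanSpace ℝ (Fin 3) → ℝ}
    (hu : ContDiff ℝ (⊤ : ℕ∞) u) (v : EuclideanSpace ℝ (Fin 3)) :
    ContDiff ℝ (⊤ : ℕ∞) (fun y => fderiv ℝ u y v) :=
  (hu.fderiv_right (m := (⊤ : ℕ∞)) (by simp)).clm_apply contDiff_const

lemma hasDerivAt_line {f : EuclideanSpace ℝ (Fin 3) → ℝ} {x : EuclideanSpace ℝ (Fin 3)}
    (hf : DifferentiableAt ℝ f x) (v : EuclideanSpace ℝ (Fin 3)) :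
    HasDerivAt (fun t : ℝ => f (x + t • v)) (fderiv ℝ f x v) 0 :=
  hf.hasFDerivAt.hasLineDerivAt v

lemma contDiffAt_hardyField {u : EuclideanSpace ℝ (Fin 3) → ℝ}
    (hu : ContDiff ℝ (⊤ : ℕ∞) u) (i : Fin 3) {x : EuclideanSpace ℝ (Fin 3)} (hx : x ≠ 0) :
    ContDiffAt ℝ (⊤ : ℕ∞) (hardyField u i) x := by
  have hq : ‖x‖ ^ 2 ≠ 0 := by positivity
  have h1 := (contDiff_fderiv_apply_const hu (EuclideanSpace.single i (1 : ℝ))).contDiffAt (x := x)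
  have h2 : ContDiffAt ℝ (⊤ : ℕ∞) (fun y : EuclideanSpace ℝ (Fin 3) => ‖y‖ ^ 2) x :=
    (contDiff_norm_sq ℝ).contDiffAt
  have h3 : ContDiffAt ℝ (⊤ : ℕ∞) (fun y : EuclideanSpace ℝ (Fin 3) => y i) x :=
    (EuclideanSpace.proj (𝕜 := ℝ) i).contDiff.contDiffAt
  exact ((hu.contDiffAt.mul h1).div h2 hq).neg.sub
    (((hu.contDiffAt.pow 2).mul h3).div (contDiffAt_const.mul (h2.pow 2)) (by positivity))

lemma fderiv_hardyField {u : EuclideanSpace ℝ (Fin 3) → ℝ}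
    (hu : ContDiff ℝ (⊤ : ℕ∞) u) (i : Fin 3) {x : EuclideanSpace ℝ (Fin 3)} (hx : x ≠ 0) :
    fderiv ℝ (hardyField u i) x (EuclideanSpace.single i (1 : ℝ)) =
      -(fderiv ℝ u x (EuclideanSpace.single i (1 : ℝ)) ^ 2 / ‖x‖ ^ 2)
      - u x * fderiv ℝ (fun y => fderiv ℝ u y (EuclideanSpace.single i (1 : ℝ))) x
          (EuclideanSpace.single i (1 : ℝ)) / ‖x‖ ^ 2
      + u x * fderiv ℝ u x (EuclideanSpace.single i (1 : ℝ)) * x i / (‖x‖ ^ 2) ^ 2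
      - u x ^ 2 / (2 * (‖x‖ ^ 2) ^ 2) + 2 * u x ^ 2 * x i ^ 2 / (‖x‖ ^ 2) ^ 3 := by
  have hq : ‖x‖ ^ 2 ≠ 0 := by positivity
  set e : EuclideanSpace ℝ (Fin 3) := EuclideanSpace.single i (1 : ℝ) with he
  have h0 := hasDerivAt_line (hu.contDiffAt.differentiableAt (by simp) : DifferentiableAt ℝ u x) e
  have h1 := hasDerivAt_line
    ((contDiff_fderiv_apply_const hu e).contDiffAt.differentiableAt (by simp) :
      DifferentiableAt ℝ (fun y => fderiv ℝ u y e) x) e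
  have h2 : HasDerivAt (fun t : ℝ => ‖x + t • e‖ ^ 2) (2 * x i) 0 := by
    have := (((hasDerivAt_id (0 : ℝ)).smul_const e).const_add x).norm_sq
    simpa [he, EuclideanSpace.inner_single_right] using this
  have h3 : HasDerivAt (fun t : ℝ => (x + t • e) i) 1 0 := by
    simpa [he] using (hasDerivAt_id (0 : ℝ)).const_add (x i)
  have hF := hasDerivAt_line ((contDiffAt_hardyField hu i hx).differentiableAt (by simp)) e
  have hG := ((h0.mul h1).div h2 (by simpa using hx)).neg.sub
    (((h0.pow 2).mul h3).div ((h2.pow 2).const_mul 2) (by simpa using hx))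
  refine (hF.unique hG).trans ?_
  simp only [zero_smul, add_zero, Pi.mul_apply, Pi.pow_apply]
  field_simp
  ring

/-- The pointwise identity behind the weighted Hardy inequality. -/
lemma sum_fderiv_hardyField_le {u : EuclideanSpace ℝ (Fin 3) → ℝ}
    (hu : ContDiff ℝ (⊤ : ℕ∞) u) {x : EuclideanSpace ℝ (Fin 3)} (hx : x ≠ 0) :
    ∑ i, fderiv ℝ (hardyField u i) x (EuclideanSpace.single i (1 : ℝ)) ≤
      -laplacian3 u x * (u x / ‖x‖ ^ 2) + 3 / 4 * (u x / ‖x‖ ^ 2) ^ 2 := by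
  have hq : 0 < ‖x‖ ^ 2 := by positivity
  have hn : ‖x‖ ^ 2 = x 0 ^ 2 + x 1 ^ 2 + x 2 ^ 2 := by
    simp [EuclideanSpace.norm_sq_eq, Fin.sum_univ_three]
  have key : 0 ≤ ∑ i, (fderiv ℝ u x (EuclideanSpace.single i (1 : ℝ))
      - x i * u x / (2 * ‖x‖ ^ 2)) ^ 2 / ‖x‖ ^ 2 := by positivity
  rw [← sub_nonneg]
  refine key.trans_eq ?_
  simp only [fderiv_hardyField hu _ hx, laplacian3, Fin.sum_univ_three]
  generalize ‖x‖ ^ 2 = q at *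
  generalize fderiv ℝ (fun y => fderiv ℝ u y _) x _ = a0
  generalize fderiv ℝ (fun y => fderiv ℝ u y _) x _ = a1
  generalize fderiv ℝ (fun y => fderiv ℝ u y _) x _ = a2
  have h2 : x 2 ^ 2 = q - x 0 ^ 2 - x 1 ^ 2 := by rw [hn]; ring
  field_simp
  ring_nf
  rw [h2]
  ring

lemma continuous_of_eq_zero_near_zero {g : EuclideanSpace ℝ (Fin 3) → ℝ}
    (h0 : g =ᶠ[𝓝 0] 0) (h : ∀ x ≠ 0, ContinuousAt g x) : Continuous g := by
  refine continuous_iff_continuousAt.2 fun x => ?_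
  rcases eq_or_ne x 0 with rfl | hx
  · exact (continuousAt_const (y := (0 : ℝ))).congr h0.symm
  · exact h x hx

lemma hardyField_eventuallyEq_zero {u : EuclideanSpace ℝ (Fin 3) → ℝ}
    {x : EuclideanSpace ℝ (Fin 3)} (h : u =ᶠ[𝓝 x] 0) (i : Fin 3) : hardyField u i =ᶠ[𝓝 x] 0 := by
  filter_upwards [h] with y hy
  simp [hardyField, hy]

lemma laplacian3_eventuallyEq_zero {u : EuclideanSpace ℝ (Fin 3) → ℝ}
    {x : EuclideanSpace ℝ (Fin 3)} (h : u =ᶠ[𝓝 x] 0) : laplacian3 u =ᶠ[𝓝 x] 0 := by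
  have h1 (i : Fin 3) : (fun y => fderiv ℝ u y (EuclideanSpace.single i (1 : ℝ))) =ᶠ[𝓝 x] 0 := by
    filter_upwards [h.fderiv (𝕜 := ℝ)] with y hy
    simp [hy]
  have h2 : ∀ᶠ y in 𝓝 x, ∀ i : Fin 3,
      fderiv ℝ (fun y => fderiv ℝ u y (EuclideanSpace.single i (1 : ℝ))) y = 0 := by
    refine Filter.eventually_all.2 fun i => ?_
    filter_upwards [(h1 i).fderiv (𝕜 := ℝ)] with y hy
    simp [hy]
  filter_upwards [h2] with y hy
  simp [laplacian3, hy]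

lemma contDiff_hardyField {u : EuclideanSpace ℝ (Fin 3) → ℝ} (hu : ContDiff ℝ (⊤ : ℕ∞) u)
    (h0 : u =ᶠ[𝓝 0] 0) (i : Fin 3) : ContDiff ℝ (⊤ : ℕ∞) (hardyField u i) := by
  refine contDiff_iff_contDiffAt.2 fun x => ?_
  rcases eq_or_ne x 0 with rfl | hx
  · exact (contDiffAt_const (c := (0 : ℝ))).congr_of_eventuallyEq
      (hardyField_eventuallyEq_zero h0 i)
  · exact contDiffAt_hardyField hu i hx

lemma HasCompactSupport.hardyField {u : EuclideanSpace ℝ (Fin 3) → ℝ} (huc : HasCompactSupport u)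
    (i : Fin 3) : HasCompactSupport (hardyField u i) :=
  HasCompactSupport.intro huc fun _ hx =>
    (hardyField_eventuallyEq_zero (notMem_tsupport_iff_eventuallyEq.1 hx) i).eq_of_nhds

lemma integrable_fderiv_apply {F : EuclideanSpace ℝ (Fin 3) → ℝ} (hF : ContDiff ℝ (⊤ : ℕ∞) F)
    (hFc : HasCompactSupport F) (v : EuclideanSpace ℝ (Fin 3)) :
    Integrable (fun x => fderiv ℝ F x v) :=
  (contDiff_fderiv_apply_const hF v).continuous.integrable_of_hasCompactSupport
    (hFc.fderiv_apply ℝ v)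

lemma integral_fderiv_apply_eq_zero {F : EuclideanSpace ℝ (Fin 3) → ℝ}
    (hF : ContDiff ℝ (⊤ : ℕ∞) F) (hFc : HasCompactSupport F) (v : EuclideanSpace ℝ (Fin 3)) :
    ∫ x, fderiv ℝ F x v = 0 := by
  have := integral_mul_fderiv_eq_neg_fderiv_mul_of_integrable (𝕜 := ℝ)
    (μ := (volume : Measure (EuclideanSpace ℝ (Fin 3))))
    (f := fun _ : EuclideanSpace ℝ (Fin 3) => (1 : ℝ)) (g := F) (v := v) (by simp)
    (by simpa using integrable_fderiv_apply hF hFc v)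
    (by simpa using hF.continuous.integrable_of_hasCompactSupport hFc)
    (by fun_prop) fun x _ => hF.differentiable (by simp) x
  simpa using this

lemma continuous_laplacian3 {u : EuclideanSpace ℝ (Fin 3) → ℝ} (hu : ContDiff ℝ (⊤ : ℕ∞) u) :
    Continuous (laplacian3 u) :=
  continuous_finsetSum _ fun _ _ =>
    (contDiff_fderiv_apply_const (contDiff_fderiv_apply_const hu _) _).continuous

/-- Estimate (3.12): if `χ` is continuous on `(0,∞)` with `χ ≥ c > 3/4`, then for every
`u ∈ C_c^∞(ℝ³ \ {0})`,
`(c - 3/4) (∫ u²/|x|⁴)^{1/2} ≤ (∫ |-Δu + χ(|x|)u/|x|²|²)^{1/2}`. -/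
theorem stmt_8 (c : ℝ) (hc : 3 / 4 < c) (χ : ℝ → ℝ)
    (hχ : ContinuousOn χ (Ioi (0 : ℝ))) (hχc : ∀ r : ℝ, 0 < r → c ≤ χ r)
    (u : EuclideanSpace ℝ (Fin 3) → ℝ) (hu : ContDiff ℝ (⊤ : ℕ∞) u) (huc : HasCompactSupport u)
    (h0 : ∃ ε : ℝ, 0 < ε ∧ ∀ x : EuclideanSpace ℝ (Fin 3), ‖x‖ < ε → u x = 0) :
    (c - 3 / 4) * Real.sqrt (∫ x : EuclideanSpace ℝ (Fin 3), (u x) ^ 2 / ‖x‖ ^ 4) ≤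
      Real.sqrt (∫ x : EuclideanSpace ℝ (Fin 3),
        (-laplacian3 u x + χ ‖x‖ * u x / ‖x‖ ^ 2) ^ 2) := by
  have hz : u =ᶠ[𝓝 0] 0 := by
    obtain ⟨ε, hε, h⟩ := h0
    filter_upwards [Metric.ball_mem_nhds 0 hε] with x hx
    exact h x (by simpa using hx)
  have hk : 0 < c - 3 / 4 := by linarith
  set k := c - 3 / 4 with hkdef
  have hA : Integrable (fun x : EuclideanSpace ℝ (Fin 3) => (u x) ^ 2 / ‖x‖ ^ 4) := by
    refine Continuous.integrable_of_hasCompactSupport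
      (continuous_of_eq_zero_near_zero ?_ fun x hx => ?_) (HasCompactSupport.intro huc fun x hx => ?_)
    · filter_upwards [hz] with x hx
      simp [hx]
    · exact (hu.continuous.continuousAt.pow 2).div (by fun_prop) (by positivity)
    · simp [image_eq_zero_of_notMem_tsupport hx]
  have hB : Integrable (fun x : EuclideanSpace ℝ (Fin 3) =>
      (-laplacian3 u x + χ ‖x‖ * u x / ‖x‖ ^ 2) ^ 2) := by
    refine Continuous.integrable_of_hasCompactSupport
      (continuous_of_eq_zero_near_zero ?_ fun x hx => ?_) (HasCompactSupport.intro huc fun x hx => ?_)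
    · filter_upwards [hz, laplacian3_eventuallyEq_zero hz] with x hx hx'
      simp [hx, hx']
    · have hχx : ContinuousAt (fun y : EuclideanSpace ℝ (Fin 3) => χ ‖y‖) x :=
        ContinuousAt.comp (g := χ) (hχ.continuousAt (Ioi_mem_nhds (norm_pos_iff.2 hx)))
          continuous_norm.continuousAt
      exact ((continuous_laplacian3 hu).continuousAt.neg.add
        ((hχx.mul hu.continuous.continuousAt).div (by fun_prop) (by positivity))).pow 2
    · have h := notMem_tsupport_iff_eventuallyEq.1 hx
      simp [h.eq_of_nhds, (laplacian3_eventuallyEq_zero h).eq_of_nhds]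
  have hDi (i : Fin 3) := integrable_fderiv_apply (contDiff_hardyField hu hz i) (huc.hardyField i)
    (EuclideanSpace.single i (1 : ℝ))
  have hD := integrable_finsetSum Finset.univ fun i _ => hDi i
  have hD0 : ∫ x, ∑ i, fderiv ℝ (hardyField u i) x (EuclideanSpace.single i (1 : ℝ)) = 0 := by
    rw [integral_finsetSum _ fun i _ => hDi i]
    exact Finset.sum_eq_zero fun i _ =>
      integral_fderiv_apply_eq_zero (contDiff_hardyField hu hz i) (huc.hardyField i) _
  have hpt (x : EuclideanSpace ℝ (Fin 3)) : k ^ 2 * ((u x) ^ 2 / ‖x‖ ^ 4)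
      + 2 * k * ∑ i, fderiv ℝ (hardyField u i) x (EuclideanSpace.single i (1 : ℝ)) ≤
      (-laplacian3 u x + χ ‖x‖ * u x / ‖x‖ ^ 2) ^ 2 := by
    rcases eq_or_ne x 0 with rfl | hx
    · have h1 (i : Fin 3) : fderiv ℝ (hardyField u i) 0 = 0 := by
        simpa using (hardyField_eventuallyEq_zero hz i).fderiv_eq (𝕜 := ℝ)
      simp [h1, sq_nonneg]
    · have hdiv := sum_fderiv_hardyField_le hu hx
      have hχx : c ≤ χ ‖x‖ := hχc _ (norm_pos_iff.2 hx)
      have e1 : (u x) ^ 2 / ‖x‖ ^ 4 = (u x / ‖x‖ ^ 2) ^ 2 := by ring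
      rw [e1, mul_div_assoc]
      set w := u x / ‖x‖ ^ 2
      have h2 : c * w ^ 2 ≤ χ ‖x‖ * w ^ 2 := by gcongr
      have h3 := mul_le_mul_of_nonneg_left hdiv (by positivity : 0 ≤ 2 * k)
      have h4 := mul_le_mul_of_nonneg_left h2 (by positivity : 0 ≤ 2 * k)
      have h5 := sq_nonneg (-laplacian3 u x + χ ‖x‖ * w - k * w)
      have hck : c = k + 3 / 4 := by rw [hkdef]; ring
      rw [hck] at h4
      linarith
  have hint := integral_mono ((hA.const_mul (k ^ 2)).add (hD.const_mul (2 * k))) hB hpt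
  rw [integral_add' (hA.const_mul (k ^ 2)) (hD.const_mul (2 * k)), integral_const_mul,
    integral_const_mul, hD0, mul_zero, add_zero] at hint
  refine Real.le_sqrt_of_sq_le ?_
  rwa [mul_pow, Real.sq_sqrt (integral_nonneg fun x => by positivity)]
end

section
/- Let s ∈ [1,2], t ≥ 0 and r ∈ [0, t+1]. Set τ₊ = 2+t+r and τ₋ = 2+t−r. Then ρ(t,r) := τ₊^{s} − τ₋^{s} − s r ( τ₊^{s−1} + τ₋^{s−1} ) ≥ 0. -/
/-- The trapezoidal rule for `x ↦ s x ^ (s - 1)` on `[a - r, a + r]` has a nonnegative defect. -/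
lemma trapezoid_rpow_defect_nonneg {s a r : ℝ} (hs1 : 1 ≤ s) (hs2 : s ≤ 2)
    (hr0 : 0 ≤ r) (hra : r < a) :
    0 ≤ (a + r) ^ s - (a - r) ^ s - s * r * ((a + r) ^ (s - 1) + (a - r) ^ (s - 1)) := by
  let f : ℝ → ℝ := fun x ↦
    (a + x) ^ s - (a - x) ^ s - s * x * ((a + x) ^ (s - 1) + (a - x) ^ (s - 1))
  have hderiv : ∀ x ∈ Set.Icc 0 r,
      HasDerivAt f (s * (s - 1) * x * ((a - x) ^ (s - 1 - 1) - (a + x) ^ (s - 1 - 1))) x := by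
    rintro x ⟨hx0, hxr⟩
    have hp : a + x ≠ 0 := by linarith
    have hm : a - x ≠ 0 := by linarith
    have hadd := (hasDerivAt_id x).const_add a
    have hsub := (hasDerivAt_id x).const_sub a
    have h := ((hadd.rpow_const (p := s) (Or.inl hp)).sub
      (hsub.rpow_const (p := s) (Or.inl hm))).sub
      (((hasDerivAt_id x).const_mul s).mul
        ((hadd.rpow_const (p := s - 1) (Or.inl hp)).add
          (hsub.rpow_const (p := s - 1) (Or.inl hm))))
    refine h.congr_deriv ?_
    simp only [id, Pi.add_apply]
    ring
  have hmono : MonotoneOn f (Set.Icc 0 r) := by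
    refine monotoneOn_of_deriv_nonneg (convex_Icc 0 r)
      (fun x hx ↦ (hderiv x hx).continuousAt.continuousWithinAt)
      (fun x hx ↦ (hderiv x (interior_subset hx)).differentiableAt.differentiableWithinAt)
      fun x hx ↦ ?_
    have hx' := interior_subset hx
    rw [(hderiv x hx').deriv]
    obtain ⟨hx0, hxr⟩ := hx'
    have hpow : (a + x) ^ (s - 1 - 1) ≤ (a - x) ^ (s - 1 - 1) :=
      Real.rpow_le_rpow_of_nonpos (by linarith) (by linarith) (by linarith)
    exact mul_nonneg (mul_nonneg (mul_nonneg (by linarith) (by linarith)) hx0)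
      (sub_nonneg.2 hpow)
  have h := hmono (Set.left_mem_Icc.2 hr0) (Set.right_mem_Icc.2 hr0) hr0
  simpa [f] using h


/-- Non-negativity of `ρ(t,r) = τ₊^s - τ₋^s - s r (τ₊^{s-1} + τ₋^{s-1})` for
`s ∈ [1,2]`, `t ≥ 0` and `0 ≤ r ≤ t+1`, where `τ₊ = 2+t+r`, `τ₋ = 2+t-r`. -/
theorem stmt_9 (s t r : ℝ) (hs1 : 1 ≤ s) (hs2 : s ≤ 2) (ht : 0 ≤ t)
    (hr0 : 0 ≤ r) (hr1 : r ≤ t + 1) :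
    0 ≤ (2 + t + r) ^ s - (2 + t - r) ^ s -
        s * r * ((2 + t + r) ^ (s - 1) + (2 + t - r) ^ (s - 1)) := by
  exact trapezoid_rpow_defect_nonneg hs1 hs2 hr0 (by linarith)
end

section
/- Let s ∈ [1,2] and define f : [0,1) → ℝ by f(x) = (1+x)^{s} − s x (1+x)^{s−1} − (1−x)^{s} − s x (1−x)^{s−1}. Then f(0) = 0, f is monotone non-decreasing on [0,1), and consequently f(x) ≥ 0 for all x ∈ [0,1). Moreover, for x ∈ (0,1) its derivative equals f′(x) = s(1−s) x ( (1+x)^{s−2} − (1−x)^{s−2} ), which is non-negative. -/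
open Set

/-- The derivative of `(1+x)^s - s x (1+x)^{s-1} - (1-x)^s - s x (1-x)^{s-1}` on `(-1,1)`. -/
theorem hasDerivAt_rpow_one_add_sub_rpow_one_sub (s : ℝ) {x : ℝ} (hx : x ∈ Ioo (-1 : ℝ) 1) :
    HasDerivAt (fun x : ℝ =>
      (1 + x) ^ s - s * x * (1 + x) ^ (s - 1) - (1 - x) ^ s - s * x * (1 - x) ^ (s - 1))
      (s * (1 - s) * x * ((1 + x) ^ (s - 2) - (1 - x) ^ (s - 2))) x := by
  have hp : 1 + x ≠ 0 := by linarith [hx.1]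
  have hm : 1 - x ≠ 0 := by linarith [hx.2]
  have hadd : HasDerivAt (fun y : ℝ => 1 + y) 1 x := (hasDerivAt_id x).const_add 1
  have hsub : HasDerivAt (fun y : ℝ => 1 - y) (-1) x := (hasDerivAt_id x).const_sub 1
  have hlin : HasDerivAt (fun y : ℝ => s * y) (s * 1) x := (hasDerivAt_id x).const_mul s
  have h := (((hadd.rpow_const (p := s) (Or.inl hp)).sub
    (hlin.mul (hadd.rpow_const (p := s - 1) (Or.inl hp)))).sub
    (hsub.rpow_const (p := s) (Or.inl hm))).sub
    (hlin.mul (hsub.rpow_const (p := s - 1) (Or.inl hm)))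
  refine h.congr_deriv ?_
  rw [show s - 1 - 1 = s - 2 by ring]
  ring

/-- The derivative of `(1+x)^s - s x (1+x)^{s-1} - (1-x)^s - s x (1-x)^{s-1}` is non-negative
on `[0,1)` when `s ∈ [1,2]`. -/
theorem mul_rpow_one_add_sub_rpow_one_sub_nonneg {s x : ℝ} (hs1 : 1 ≤ s) (hs2 : s ≤ 2)
    (hx : x ∈ Ico (0 : ℝ) 1) :
    0 ≤ s * (1 - s) * x * ((1 + x) ^ (s - 2) - (1 - x) ^ (s - 2)) := by
  have hle : (1 + x) ^ (s - 2) ≤ (1 - x) ^ (s - 2) :=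
    Real.rpow_le_rpow_of_nonpos (by linarith [hx.2]) (by linarith [hx.1]) (by linarith)
  have hcoef : s * (1 - s) * x ≤ 0 :=
    mul_nonpos_of_nonpos_of_nonneg
      (mul_nonpos_of_nonneg_of_nonpos (by linarith) (by linarith)) hx.1
  exact mul_nonneg_of_nonpos_of_nonpos hcoef (by linarith)

/-- Properties of `f(x) = (1+x)^s - s x (1+x)^{s-1} - (1-x)^s - s x (1-x)^{s-1}` for
`s ∈ [1,2]`: `f(0) = 0`, `f` is non-decreasing on `[0,1)`, hence `f ≥ 0` on `[0,1)`,
and on `(0,1)` its derivative is `s(1-s)x((1+x)^{s-2} - (1-x)^{s-2}) ≥ 0`. -/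
theorem stmt_10 (s : ℝ) (hs1 : 1 ≤ s) (hs2 : s ≤ 2) :
    let f : ℝ → ℝ := fun x =>
      (1 + x) ^ s - s * x * (1 + x) ^ (s - 1) - (1 - x) ^ s - s * x * (1 - x) ^ (s - 1)
    f 0 = 0 ∧ MonotoneOn f (Ico (0 : ℝ) 1) ∧ (∀ x ∈ Ico (0 : ℝ) 1, 0 ≤ f x) ∧
      ∀ x ∈ Ioo (0 : ℝ) 1,
        HasDerivAt f (s * (1 - s) * x * ((1 + x) ^ (s - 2) - (1 - x) ^ (s - 2))) x ∧
          0 ≤ s * (1 - s) * x * ((1 + x) ^ (s - 2) - (1 - x) ^ (s - 2)) := by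
  intro f
  have hderiv : ∀ x ∈ Ico (0 : ℝ) 1,
      HasDerivAt f (s * (1 - s) * x * ((1 + x) ^ (s - 2) - (1 - x) ^ (s - 2))) x :=
    fun x hx => hasDerivAt_rpow_one_add_sub_rpow_one_sub s ⟨by linarith [hx.1], hx.2⟩
  have hzero : f 0 = 0 := by simp [f]
  have hmono : MonotoneOn f (Ico (0 : ℝ) 1) := by
    refine monotoneOn_of_deriv_nonneg (convex_Ico 0 1)
      (fun x hx => (hderiv x hx).continuousAt.continuousWithinAt)
      (fun x hx => (hderiv x (interior_subset hx)).differentiableAt.differentiableWithinAt)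
      fun x hx => ?_
    rw [(hderiv x (interior_subset hx)).deriv]
    exact mul_rpow_one_add_sub_rpow_one_sub_nonneg hs1 hs2 (interior_subset hx)
  refine ⟨hzero, hmono, fun x hx => ?_, fun x hx => ⟨hderiv x (Ioo_subset_Ico_self hx),
    mul_rpow_one_add_sub_rpow_one_sub_nonneg hs1 hs2 (Ioo_subset_Ico_self hx)⟩⟩
  rw [← hzero]
  exact hmono ⟨le_rfl, zero_lt_one⟩ hx hx.1
end

section
/- Let s ≥ 0 and k ≥ 1. Let φ : [0,∞) → ℝ be continuous on [0,∞), continuously differentiable on (0,∞), and satisfy φ(r) = 0 for r ≥ k. Then ∫₀^∞ (1+k−r)^{s} φ(r)² dr ≤ 2 ∫₀^∞ (1+k−r)^{s} φ(r) ( φ′(r) + φ(r)/r ) r dr, provided the right-hand integral is finite. -/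
open Set MeasureTheory

/-- One-dimensional inequality behind the weighted Hardy estimate: for `s ≥ 0`, `k ≥ 1`
and `φ` continuous on `[0,∞)`, `C¹` on `(0,∞)`, vanishing for `r ≥ k`,
`∫₀^∞ (1+k-r)^s φ² dr ≤ 2 ∫₀^∞ (1+k-r)^s φ (φ' + φ/r) r dr`,
provided the right-hand integral is finite. -/
theorem stmt_15 (s k : ℝ) (hs : 0 ≤ s) (hk : 1 ≤ k) (φ : ℝ → ℝ)
    (hcont : ContinuousOn φ (Ici (0 : ℝ)))
    (hdiff : ContDiffOn ℝ 1 φ (Ioi (0 : ℝ)))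
    (hsupp : ∀ r : ℝ, k ≤ r → φ r = 0)
    (hint : IntegrableOn
      (fun r => (1 + k - r) ^ s * φ r * (deriv φ r + φ r / r) * r) (Ioi 0)) :
    (∫ r in Ioi (0 : ℝ), (1 + k - r) ^ s * (φ r) ^ 2) ≤
      2 * ∫ r in Ioi (0 : ℝ), (1 + k - r) ^ s * φ r * (deriv φ r + φ r / r) * r := by
  have hwcont : ContinuousOn (fun r : ℝ => (1 + k - r) ^ s) (Icc 0 k) :=
    ContinuousOn.rpow_const (by fun_prop) fun _ _ => Or.inr hs
  have hφcont : ContinuousOn φ (Icc 0 k) := hcont.mono Icc_subset_Ici_self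
  have hLint : IntegrableOn (fun r => (1 + k - r) ^ s * (φ r) ^ 2) (Icc 0 k) :=
    (hwcont.mul (hφcont.pow 2)).integrableOn_Icc
  have hRint : IntegrableOn
      (fun r => (1 + k - r) ^ s * φ r * (deriv φ r + φ r / r) * r) (Icc 0 k) :=
    integrableOn_Icc_iff_integrableOn_Ioc (by simp) |>.mpr (hint.mono_set Ioc_subset_Ioi_self)
  have hderiv : ∀ x ∈ Ioo 0 k, HasDerivWithinAt (fun r => (1 + k - r) ^ s * (φ r) ^ 2 * r)
      ((-1 * s * (1 + k - x) ^ (s - 1) * (φ x) ^ 2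
        + (1 + k - x) ^ s * (2 * φ x * deriv φ x)) * x + (1 + k - x) ^ s * (φ x) ^ 2)
      (Ioi x) x := by
    intro x hx
    have hφ : HasDerivAt φ (deriv φ x) x :=
      ((hdiff.contDiffAt (Ioi_mem_nhds hx.1)).differentiableAt one_ne_zero).hasDerivAt
    have hw : HasDerivAt (fun r : ℝ => (1 + k - r) ^ s) (-1 * s * (1 + k - x) ^ (s - 1)) x :=
      ((hasDerivAt_id x).const_sub (1 + k)).rpow_const (Or.inl (by simp only [id]; linarith [hx.2]))
    refine (((hw.mul (hφ.pow 2)).mul (hasDerivAt_id x)).congr_deriv ?_).hasDerivWithinAt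
    simp
  have hle := intervalIntegral.sub_le_integral_of_hasDeriv_right_of_le (zero_le_one.trans hk)
    ((hwcont.mul (hφcont.pow 2)).mul continuousOn_id) hderiv
    ((hRint.const_mul 2).sub hLint) fun x hx => by
      have hnonneg : 0 ≤ s * (1 + k - x) ^ (s - 1) * (φ x) ^ 2 * x :=
        mul_nonneg (mul_nonneg (mul_nonneg hs (Real.rpow_nonneg (by linarith [hx.2]) _))
          (sq_nonneg _)) hx.1.le
      have hx0 : x ≠ 0 := hx.1.ne'
      have hcancel : (deriv φ x + φ x / x) * x = deriv φ x * x + φ x := by field_simp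
      simp only [Pi.sub_apply, mul_assoc _ (deriv φ x + φ x / x) x, hcancel]
      linarith
  have hrestrict : ∀ f : ℝ → ℝ, (∀ r, k ≤ r → f r = 0) →
      ∫ r in Ioi (0 : ℝ), f r = ∫ r in Ioc 0 k, f r := fun f hf =>
    setIntegral_eq_of_subset_of_forall_sdiff_eq_zero measurableSet_Ioi Ioc_subset_Ioi_self
      fun r hr => hf r (le_of_not_ge fun h => hr.2 ⟨hr.1, h⟩)
  rw [hrestrict _ fun r hr => by simp [hsupp r hr], hrestrict _ fun r hr => by simp [hsupp r hr],
    ← integral_const_mul, ← sub_nonneg, ← integral_sub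
      ((hRint.mono_set Ioc_subset_Icc_self).const_mul 2) (hLint.mono_set Ioc_subset_Icc_self)]
  simpa [hsupp k le_rfl, intervalIntegral.integral_of_le (zero_le_one.trans hk)] using hle
end
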